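/- Let α ∈ (0,1), ω ∈ (0, π/2], d_0 > 0 and a, b, c ≥ 0. Then there exists a constant Θ > 0, depending only on a, b, c, d_0, sin ω and α, with the following property. Let r > 0 and h_0, h_1, h_2 ≥ 0 with h_0 r ≤ a, h_1 r^{1+α} ≤ b, h_2 r ≤ c; let 𝓗 : ℝ⁴ × S³ → ℝ be of the form 𝓗(X,Z) = 𝓗̄(X)·Z for a continuous 𝓗̄ : ℝ⁴ → ℝ⁴, satisfying |𝓗(X,Z)| ≤ h_0/2 for all X ∈ ℝ⁴, Z ∈ S³, and |𝓗(X_1,Z_1) − 𝓗(X_2,Z_2)| ≤ h_1 |X_1 − X_2|^α + h_2 |Z_1 − Z_2| for all X_1, X_2 ∈ ℝ⁴, Z_1, Z_2 ∈ S³. Let X = (x¹,x²,x³,x⁴) : B → ℝ⁴ be a C² conformally parametrized immersion with area element W, continuous up to the closure of B, such that: (A1) the plane mapping w ↦ (x¹(w), x²(w)) is injective on B with everywhere positive Jacobian determinant, and there are C² functions φ, ψ with x³(w) = φ(x¹(w), x²(w)) and x⁴(w) = ψ(x¹(w), x²(w)) on B; X satisfies ΔX = 2𝓗(X,N_1) W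 N_1 + 2𝓗(X,N_2) W N_2 in B for C¹ maps N_1, N_2 : B → S³ forming at every point an orthonormal basis of the orthogonal complement of span{X_u, X_v}; (A3) X(0,0) = 0 and every continuous, piecewise C¹ curve γ : [0,1] → closure(B) with γ(0) = (0,0) and |γ(1)| = 1 satisfies ∫₀¹ |(d/dt)(X∘γ)(t)| dt ≥ r; (A4) ∬_B |∇X|² du dv ≤ d_0 r²; (A5) every unit vector N ∈ ℝ⁴ orthogonal to X_u(w) and X_v(w) satisfies |N·e_1| ≤ cos ω, for every w ∈ B. Then for every unit vector N ∈ ℝ⁴ orthogonal to X_u(0,0) and X_v(0,0), the quantities H = (ΔX(0,0)·N)/(2W(0,0)) and K = ((X_uu(0,0)·N)(X_vv(0,0)·N) − (X_uv(0,0)·N)²)/W(0,0)² satisfy 4H² − 2K ≤ (1/r²)((h_0 r)² + Θ). -/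

import Mathlib

open scoped RealInnerProductSpace
open Metric Real

noncomputable section

abbrev E2 : Type := EuclideanSpace ℝ (Fin 2)
abbrev E4 : Type := EuclideanSpace ℝ (Fin 4)

/-- Partial derivative of a map `X : ℝ² → ℝ⁴` in the `i`-th coordinate direction. -/
def pd (X : E2 → E4) (i : Fin 2) (w : E2) : E4 :=
  fderiv ℝ X w (EuclideanSpace.single i 1)

/-- Second partial derivative `X_{uⁱ uʲ}`. -/
def pd2 (X : E2 → E4) (i j : Fin 2) (w : E2) : E4 :=
  pd (pd X i) j w

/-- Partial derivative of a scalar function on `ℝ²`. -/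
def pdR (f : E2 → ℝ) (i : Fin 2) (w : E2) : ℝ :=
  fderiv ℝ f w (EuclideanSpace.single i 1)

/-- Twice the Wirtinger derivative `∂/∂z̄`. -/
def dbar (h : ℂ → ℂ) (z : ℂ) : ℂ := fderiv ℝ h z 1 + Complex.I * fderiv ℝ h z Complex.I

/-- The circular Fourier integral of `h` with frequency `k` around `z₀`. -/
def circCoeff (h : ℂ → ℂ) (k : ℤ) (z₀ : ℂ) (ρ : ℝ) : ℂ :=
  ∫ θ in -π..π, h (circleMap z₀ ρ θ) * Complex.exp (-(k * θ * Complex.I))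

lemma hasDerivAt_circleMap_radius (z₀ : ℂ) (ρ θ : ℝ) :
    HasDerivAt (fun ρ : ℝ => circleMap z₀ ρ θ) (Complex.exp (θ * Complex.I)) ρ := by
  have h : HasDerivAt (fun ρ : ℝ => z₀ + (ρ : ℂ) * Complex.exp (θ * Complex.I))
      ((1 : ℂ) * Complex.exp (θ * Complex.I)) ρ :=
    ((Complex.ofRealCLM.hasDerivAt (x := ρ)).mul_const _).const_add _
  simpa [circleMap] using h

lemma norm_fourier_factor (k : ℤ) (θ : ℝ) : ‖Complex.exp (-(k * θ * Complex.I))‖ = 1 := by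
  have : (-(k * θ * Complex.I) : ℂ) = ((-(k * θ) : ℝ) : ℂ) * Complex.I := by push_cast; ring
  rw [this, Complex.norm_exp_ofReal_mul_I]

lemma norm_circCoeff_le {h : ℂ → ℂ} {k : ℤ} {z₀ : ℂ} {ρ M : ℝ} (hρ : 0 ≤ ρ)
    (hM : ∀ z ∈ sphere z₀ ρ, ‖h z‖ ≤ M) : ‖circCoeff h k z₀ ρ‖ ≤ 2 * π * M := by
  have := intervalIntegral.norm_integral_le_of_norm_le_const (a := -π) (b := π) (C := M)
    (f := fun θ : ℝ => h (circleMap z₀ ρ θ) * Complex.exp (-(k * θ * Complex.I))) (by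
      intro θ _
      rw [norm_mul, norm_fourier_factor, mul_one]
      exact hM _ (circleMap_mem_sphere _ hρ _))
  refine this.trans (le_of_eq ?_)
  rw [abs_of_pos (by linarith [pi_pos])]; ring

lemma circleMap_mem_closedBall_of_le {z₀ : ℂ} {ρ R θ : ℝ} (hρ : 0 ≤ ρ) (h : ρ ≤ R) :
    circleMap z₀ ρ θ ∈ closedBall z₀ R :=
  closedBall_subset_closedBall h (circleMap_mem_closedBall _ hρ _)

lemma continuous_comp_circleMap {E : Type*} [TopologicalSpace E] {h : ℂ → E} {z₀ : ℂ} {ρ R : ℝ}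
    (hh : ContinuousOn h (closedBall z₀ R)) (hρ : 0 ≤ ρ) (hR : ρ ≤ R) :
    Continuous fun θ : ℝ => h (circleMap z₀ ρ θ) :=
  hh.comp_continuous (continuous_circleMap _ _) fun _ => circleMap_mem_closedBall_of_le hρ hR

lemma continuous_uncurry_circleMap (z₀ : ℂ) :
    Continuous fun p : ℝ × ℝ => circleMap z₀ p.1 p.2 := by
  unfold circleMap; fun_prop

lemma continuousOn_circCoeff {h : ℂ → ℂ} {z₀ : ℂ} {R : ℝ} (k : ℤ)
    (hh : ContinuousOn h (closedBall z₀ R)) :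
    ContinuousOn (circCoeff h k z₀) (Set.Icc 0 R) := by
  obtain hR | hR := lt_or_ge R 0
  · simp [Set.Icc_eq_empty (not_le.mpr hR)]
  have key : Continuous fun ρ : ℝ => circCoeff h k z₀ (Set.projIcc 0 R hR ρ) := by
    unfold circCoeff
    apply intervalIntegral.continuous_parametric_intervalIntegral_of_continuous'
    have h1 : Continuous fun p : ℝ × ℝ =>
        h (circleMap z₀ (Set.projIcc 0 R hR p.1 : ℝ) p.2) := by
      refine hh.comp_continuous ?_ fun p => circleMap_mem_closedBall_of_le
        (Set.projIcc 0 R hR p.1).2.1 (Set.projIcc 0 R hR p.1).2.2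
      exact (continuous_uncurry_circleMap z₀).comp
        ((continuous_subtype_val.comp ((continuous_projIcc (h := hR)).comp continuous_fst)).prodMk
          continuous_snd)
    refine h1.mul ?_
    fun_prop
  refine key.continuousOn.congr fun ρ hρ => ?_
  simp [Set.projIcc_of_mem hR hρ]

/-- The radial derivative of a circular Fourier integral. -/
lemma hasDerivAt_circCoeff {h : ℂ → ℂ} {U : Set ℂ} (hU : IsOpen U) (hh : ContDiffOn ℝ 1 h U)
    {z₀ : ℂ} {R : ℝ} (hR : closedBall z₀ R ⊆ U) (k : ℤ) {ρ : ℝ} (hρ : ρ ∈ Set.Ioo 0 R) :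
    HasDerivAt (circCoeff h k z₀)
      ((k * circCoeff h k z₀ ρ + ρ * circCoeff (dbar h) (k + 1) z₀ ρ) / ρ) ρ := by
  have hd : ∀ z ∈ U, HasFDerivAt h (fderiv ℝ h z) z := fun z hz =>
    ((hh.differentiableOn one_ne_zero).differentiableAt (hU.mem_nhds hz)).hasFDerivAt
  have hD : ContinuousOn (fderiv ℝ h) U := hh.continuousOn_fderiv_of_isOpen hU le_rfl
  have hDc : ContinuousOn (fderiv ℝ h) (closedBall z₀ R) := hD.mono hR
  obtain ⟨C, hC⟩ := (isCompact_closedBall z₀ R).exists_bound_of_continuousOn hDc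
  have hhc : ContinuousOn h (closedBall z₀ R) := hh.continuousOn.mono hR
  have hρ0 : (ρ : ℂ) ≠ 0 := by exact_mod_cast hρ.1.ne'
  have cexp : Continuous fun θ : ℝ => Complex.exp (-(k * θ * Complex.I)) := by fun_prop
  have main := intervalIntegral.hasDerivAt_integral_of_dominated_loc_of_deriv_le
    (a := -π) (b := π) (μ := MeasureTheory.volume) (x₀ := ρ) (s := Set.Ioo 0 R)
    (F := fun ρ θ : ℝ => h (circleMap z₀ ρ θ) * Complex.exp (-(k * θ * Complex.I)))
    (F' := fun ρ θ : ℝ => fderiv ℝ h (circleMap z₀ ρ θ) (Complex.exp (θ * Complex.I)) *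
      Complex.exp (-(k * θ * Complex.I))) (bound := fun _ => C)
    (isOpen_Ioo.mem_nhds hρ)
    (by
      filter_upwards [isOpen_Ioo.mem_nhds hρ] with x hx
      exact ((continuous_comp_circleMap hhc hx.1.le hx.2.le).mul cexp).aestronglyMeasurable)
    (((continuous_comp_circleMap hhc hρ.1.le hρ.2.le).mul cexp).intervalIntegrable _ _)
    ((((continuous_comp_circleMap hDc hρ.1.le hρ.2.le).clm_apply (by fun_prop)).mul
      cexp).aestronglyMeasurable)
    (by
      refine Filter.Eventually.of_forall fun θ _ x hx => ?_
      rw [norm_mul, norm_fourier_factor, mul_one]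
      refine ((fderiv ℝ h _).le_opNorm _).trans ?_
      rw [Complex.norm_exp_ofReal_mul_I, mul_one]
      exact hC _ (circleMap_mem_closedBall_of_le hx.1.le hx.2.le))
    (by simp)
    (by
      refine Filter.Eventually.of_forall fun θ _ x hx => ?_
      have h1 := (hd _ (hR (circleMap_mem_closedBall_of_le (θ := θ) hx.1.le hx.2.le))).comp_hasDerivAt
        x (hasDerivAt_circleMap_radius z₀ x θ)
      exact h1.mul_const _)
  refine main.2.congr_deriv ?_
  rw [eq_div_iff hρ0]
  set G : ℝ → ℂ := fun θ => h (circleMap z₀ ρ θ) * Complex.exp (-(k * θ * Complex.I)) with hG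
  set A : ℝ → ℂ := fun θ => fderiv ℝ h (circleMap z₀ ρ θ) (Complex.exp (θ * Complex.I)) *
      Complex.exp (-(k * θ * Complex.I)) with hA
  set B : ℝ → ℂ := fun θ => fderiv ℝ h (circleMap z₀ ρ θ) (circleMap 0 ρ θ * Complex.I) *
      Complex.exp (-(k * θ * Complex.I)) with hB
  set D : ℝ → ℂ := fun θ => dbar h (circleMap z₀ ρ θ) *
      Complex.exp (-((k + 1 : ℤ) * θ * Complex.I)) with hDdef
  have cG : Continuous G := (continuous_comp_circleMap hhc hρ.1.le hρ.2.le).mul cexp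
  have cA : Continuous A :=
    ((continuous_comp_circleMap hDc hρ.1.le hρ.2.le).clm_apply (by fun_prop)).mul cexp
  have cB : Continuous B :=
    ((continuous_comp_circleMap hDc hρ.1.le hρ.2.le).clm_apply
      ((continuous_circleMap _ _).mul continuous_const)).mul cexp
  have cD : Continuous D := by
    have := continuous_comp_circleMap hDc hρ.1.le hρ.2.le
    refine Continuous.mul ?_ (by fun_prop)
    exact (this.clm_apply continuous_const).add
      (continuous_const.mul (this.clm_apply continuous_const))
  have ibp : ∫ θ in -π..π, (B θ - k * Complex.I * G θ) = 0 := by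
    have hder : ∀ θ : ℝ, HasDerivAt G (B θ - k * Complex.I * G θ) θ := by
      intro θ
      have h1 := (hd _ (hR (circleMap_mem_closedBall_of_le (θ := θ) hρ.1.le hρ.2.le))).comp_hasDerivAt
        θ (hasDerivAt_circleMap z₀ ρ θ)
      have h2 : HasDerivAt (fun θ : ℝ => Complex.exp (-(k * θ * Complex.I)))
          (Complex.exp (-(k * θ * Complex.I)) * (-(k * 1 * Complex.I))) θ := by
        have h3 : HasDerivAt (fun θ : ℝ => (-(k * (θ : ℂ) * Complex.I))) (-(k * 1 * Complex.I)) θ :=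
          (((Complex.ofRealCLM.hasDerivAt (x := θ)).const_mul (k : ℂ)).mul_const Complex.I).neg
        exact h3.cexp
      refine (h1.mul h2).congr_deriv ?_
      simp only [hB, hG, Function.comp]
      ring
    rw [intervalIntegral.integral_eq_sub_of_hasDerivAt (fun θ _ => hder θ)
      ((cB.sub (continuous_const.mul cG)).intervalIntegrable _ _)]
    have e1 : circleMap z₀ ρ π = circleMap z₀ ρ (-π) := by
      simp [circleMap, Complex.exp_pi_mul_I, Complex.exp_neg]
    have e2 : Complex.exp (-(k * (π : ℝ) * Complex.I)) =
        Complex.exp (-(k * ((-π : ℝ) : ℂ) * Complex.I)) := by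
      rw [Complex.exp_eq_exp_iff_exists_int]
      exact ⟨-k, by push_cast; ring⟩
    simp only [hG, e1, e2, sub_self]
  have alg : ∀ θ, A θ * ρ = k * G θ + ρ * D θ - Complex.I * (B θ - k * Complex.I * G θ) := by
    intro θ
    have e3 : Complex.exp (-((k + 1 : ℤ) * θ * Complex.I)) =
        Complex.exp (-(k * θ * Complex.I)) * Complex.exp (-(θ * Complex.I)) := by
      rw [← Complex.exp_add]; congr 1; push_cast; ring
    have hlin : ∀ v : ℂ, fderiv ℝ h (circleMap z₀ ρ θ) v =
        v.re * fderiv ℝ h (circleMap z₀ ρ θ) 1 +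
          v.im * fderiv ℝ h (circleMap z₀ ρ θ) Complex.I := by
      intro v
      have : v = v.re • (1 : ℂ) + v.im • Complex.I := by
        simp [Complex.re_add_im]
      conv_lhs => rw [this, map_add, map_smul, map_smul]
      simp
    have e4 : circleMap 0 ρ θ * Complex.I = (ρ : ℂ) * (Complex.exp (θ * Complex.I) * Complex.I) := by
      simp [circleMap]; ring
    have e5 : fderiv ℝ h (circleMap z₀ ρ θ) (circleMap 0 ρ θ * Complex.I) =
        ρ * fderiv ℝ h (circleMap z₀ ρ θ) (Complex.exp (θ * Complex.I) * Complex.I) := by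
      rw [e4, ← Complex.real_smul, map_smul, Complex.real_smul]
    simp only [hA, hB, hG, hDdef, e3, e5, dbar]
    rw [hlin (Complex.exp (θ * Complex.I)), hlin (Complex.exp (θ * Complex.I) * Complex.I)]
    have e6 : Complex.exp (-(θ * Complex.I)) = Real.cos θ - Real.sin θ * Complex.I := by
      have : (-(θ * Complex.I) : ℂ) = ((-θ : ℝ) : ℂ) * Complex.I := by push_cast; ring
      rw [this, Complex.exp_mul_I, ← Complex.ofReal_cos, ← Complex.ofReal_sin]
      simp [sub_eq_add_neg]
    have e7 : (Complex.exp (θ * Complex.I) * Complex.I).re = -Real.sin θ := by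
      simp [Complex.exp_ofReal_mul_I_re, Complex.exp_ofReal_mul_I_im]
    have e8 : (Complex.exp (θ * Complex.I) * Complex.I).im = Real.cos θ := by
      simp [Complex.exp_ofReal_mul_I_re, Complex.exp_ofReal_mul_I_im]
    rw [e6, e7, e8, Complex.exp_ofReal_mul_I_re, Complex.exp_ofReal_mul_I_im]
    push_cast
    have hI : Complex.I * Complex.I = -1 := Complex.I_mul_I
    linear_combination (-(k * (h (circleMap z₀ ρ θ)) * Complex.exp (-(k * θ * Complex.I))) +
      (ρ : ℂ) * Complex.exp (-(k * θ * Complex.I)) * (Complex.sin θ) *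
        fderiv ℝ h (circleMap z₀ ρ θ) Complex.I) * hI
  have step : (∫ θ in -π..π, A θ) * ρ =
      k * (∫ θ in -π..π, G θ) + ρ * (∫ θ in -π..π, D θ) -
        Complex.I * ∫ θ in -π..π, (B θ - k * Complex.I * G θ) := by
    rw [← intervalIntegral.integral_mul_const, ← intervalIntegral.integral_const_mul,
      ← intervalIntegral.integral_const_mul, ← intervalIntegral.integral_const_mul,
      ← intervalIntegral.integral_add, ← intervalIntegral.integral_sub]
    · exact intervalIntegral.integral_congr fun θ _ => alg θ
    · exact ((continuous_const.mul cG).add (continuous_const.mul cD)).intervalIntegrable _ _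
    · exact (continuous_const.mul (cB.sub (continuous_const.mul cG))).intervalIntegrable _ _
    · exact (continuous_const.mul cG).intervalIntegrable _ _
    · exact (continuous_const.mul cD).intervalIntegrable _ _
  rw [ibp, mul_zero, sub_zero] at step
  exact step

lemma norm_sub_le_of_hasDerivAt_Ioo {F F' : ℝ → ℂ} {B B' : ℝ → ℝ} {R b : ℝ} {L : ℂ} (hR : 0 < R)
    (hF : ContinuousOn F (Set.Ioc 0 R)) (hF' : ∀ x ∈ Set.Ioo 0 R, HasDerivAt F (F' x) x)
    (hB : ContinuousOn B (Set.Ioc 0 R)) (hB' : ∀ x ∈ Set.Ioo 0 R, HasDerivAt B (B' x) x)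
    (bound : ∀ x ∈ Set.Ioo 0 R, ‖F' x‖ ≤ B' x)
    (hL : Filter.Tendsto F (nhdsWithin 0 (Set.Ioi 0)) (nhds L))
    (hb : Filter.Tendsto B (nhdsWithin 0 (Set.Ioi 0)) (nhds b)) :
    ‖F R - L‖ ≤ B R - b := by
  refine le_of_tendsto_of_tendsto (tendsto_const_nhds.sub hL).norm (tendsto_const_nhds.sub hb) ?_
  filter_upwards [Ioo_mem_nhdsGT hR] with ε hε
  have sub1 : Set.Icc ε R ⊆ Set.Ioc 0 R := fun x hx => ⟨hε.1.trans_le hx.1, hx.2⟩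
  have sub2 : Set.Ico ε R ⊆ Set.Ioo 0 R := fun x hx => ⟨hε.1.trans_le hx.1, hx.2⟩
  exact image_norm_le_of_norm_deriv_right_le_deriv_boundary' (a := ε) (b := R)
    (f := fun x => F x - F ε) (f' := F') (B := fun x => B x - B ε) (B' := B')
    ((hF.mono sub1).sub continuousOn_const)
    (fun x hx => ((hF' x (sub2 hx)).sub_const _).hasDerivWithinAt) (by simp)
    ((hB.mono sub1).sub continuousOn_const)
    (fun x hx => ((hB' x (sub2 hx)).sub_const _).hasDerivWithinAt)
    (fun x hx => bound x (sub2 hx)) (Set.right_mem_Icc.mpr hε.2.le)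

lemma tendsto_zero_of_continuousOn_Icc {E : Type*} [TopologicalSpace E] {F : ℝ → E} {R : ℝ}
    (hR : 0 < R) (hF : ContinuousOn F (Set.Icc 0 R)) :
    Filter.Tendsto F (nhdsWithin 0 (Set.Ioi 0)) (nhds (F 0)) := by
  have h := hF 0 ⟨le_rfl, hR.le⟩
  refine h.mono_left ?_
  rw [← nhdsWithin_Ioc_eq_nhdsGT hR]
  exact nhdsWithin_mono _ Set.Ioc_subset_Icc_self

lemma circCoeff_zero_radius (h : ℂ → ℂ) (z₀ : ℂ) : circCoeff h 0 z₀ 0 = 2 * π * h z₀ := by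
  simp [circCoeff]
  left; ring

/-- Approximate mean value property for functions with bounded `∂/∂z̄` derivative. -/
lemma norm_circCoeff_zero_sub_le {h : ℂ → ℂ} {U : Set ℂ} (hU : IsOpen U) (hh : ContDiffOn ℝ 1 h U)
    {z₀ : ℂ} {R S : ℝ} (hR : closedBall z₀ R ⊆ U) (hS : ∀ z ∈ closedBall z₀ R, ‖dbar h z‖ ≤ S)
    (hR0 : 0 ≤ R) : ‖circCoeff h 0 z₀ R - 2 * π * h z₀‖ ≤ 2 * π * S * R := by
  obtain rfl | hRpos := hR0.eq_or_lt
  · simp [circCoeff_zero_radius]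
  have hc := continuousOn_circCoeff 0 (hh.continuousOn.mono hR)
  have := norm_sub_le_of_hasDerivAt_Ioo (B := fun x => 2 * π * S * x) (B' := fun _ => 2 * π * S)
    hRpos (hc.mono Set.Ioc_subset_Icc_self)
    (fun x hx => hasDerivAt_circCoeff hU hh hR 0 hx) (by fun_prop)
    (fun x _ => by simpa using (hasDerivAt_id x).const_mul (2 * π * S))
    (fun x hx => by
      have hx0 : (x : ℂ) ≠ 0 := by exact_mod_cast hx.1.ne'
      have : (((0 : ℤ) : ℂ) * circCoeff h 0 z₀ x + x * circCoeff (dbar h) (0 + 1) z₀ x) / x =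
          circCoeff (dbar h) (0 + 1) z₀ x := by field_simp; simp
      rw [this]
      exact norm_circCoeff_le hx.1.le fun z hz =>
        hS z (closedBall_subset_closedBall hx.2.le (sphere_subset_closedBall hz)))
    (tendsto_zero_of_continuousOn_Icc hRpos hc)
    (tendsto_zero_of_continuousOn_Icc (F := fun x => 2 * π * S * x) hRpos (by fun_prop))
  simpa [circCoeff_zero_radius] using this

/-- The gradient of a real function as a complex number `f_u - i f_v`. -/
def cgrad (f : ℂ → ℝ) (z : ℂ) : ℂ := fderiv ℝ f z 1 - Complex.I * fderiv ℝ f z Complex.I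

/-- The Laplacian of a real function on the plane. -/
def lap (f : ℂ → ℝ) (z : ℂ) : ℝ :=
  fderiv ℝ (fun w => fderiv ℝ f w 1) z 1 + fderiv ℝ (fun w => fderiv ℝ f w Complex.I) z Complex.I

lemma contDiffOn_fderiv_apply {E F : Type*} [NormedAddCommGroup E] [NormedSpace ℝ E]
    [NormedAddCommGroup F] [NormedSpace ℝ F] {f : E → F} {U : Set E} (hU : IsOpen U)
    (hf : ContDiffOn ℝ 2 f U) (v : E) :
    ContDiffOn ℝ 1 (fun w => fderiv ℝ f w v) U :=
  (hf.fderiv_of_isOpen hU (by norm_num)).clm_apply contDiffOn_const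

lemma contDiffOn_cgrad {f : ℂ → ℝ} {U : Set ℂ} (hU : IsOpen U) (hf : ContDiffOn ℝ 2 f U) :
    ContDiffOn ℝ 1 (cgrad f) U := by
  have h1 := contDiffOn_fderiv_apply hU hf 1
  have h2 := contDiffOn_fderiv_apply hU hf Complex.I
  exact (Complex.ofRealCLM.contDiff.comp_contDiffOn h1).sub
    (contDiffOn_const.mul (Complex.ofRealCLM.contDiff.comp_contDiffOn h2))

lemma fderiv_fderiv_comm {E F : Type*} [NormedAddCommGroup E] [NormedSpace ℝ E]
    [NormedAddCommGroup F] [NormedSpace ℝ F] {f : E → F} {U : Set E} (hU : IsOpen U)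
    (hf : ContDiffOn ℝ 2 f U) {z : E} (hz : z ∈ U) (v w : E) :
    fderiv ℝ (fun x => fderiv ℝ f x v) z w = fderiv ℝ (fun x => fderiv ℝ f x w) z v := by
  have hd : DifferentiableAt ℝ (fderiv ℝ f) z :=
    ((hf.fderiv_of_isOpen (m := 1) hU (by norm_num)).differentiableOn one_ne_zero).differentiableAt
      (hU.mem_nhds hz)
  have hs : IsSymmSndFDerivAt ℝ f z :=
    (hf.contDiffAt (hU.mem_nhds hz)).isSymmSndFDerivAt (by simp)
  have e : ∀ v : E, fderiv ℝ (fun x => fderiv ℝ f x v) z = (fderiv ℝ (fderiv ℝ f) z).flip v := by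
    intro v
    rw [fderiv_clm_apply hd (differentiableAt_const v)]
    simp
  rw [e, e]
  exact hs w v

lemma hasFDerivAt_cgrad {f : ℂ → ℝ} {U : Set ℂ} (hU : IsOpen U) (hf : ContDiffOn ℝ 2 f U)
    {z : ℂ} (hz : z ∈ U) (v : ℂ) :
    fderiv ℝ (cgrad f) z v = fderiv ℝ (fun w => fderiv ℝ f w 1) z v -
      Complex.I * fderiv ℝ (fun w => fderiv ℝ f w Complex.I) z v := by
  have h1 := ((contDiffOn_fderiv_apply hU hf 1).differentiableOn one_ne_zero).differentiableAt
    (hU.mem_nhds hz)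
  have h2 := ((contDiffOn_fderiv_apply hU hf Complex.I).differentiableOn
    one_ne_zero).differentiableAt (hU.mem_nhds hz)
  have h := (Complex.ofRealCLM.hasFDerivAt.comp z h1.hasFDerivAt).sub
    ((Complex.ofRealCLM.hasFDerivAt.comp z h2.hasFDerivAt).const_mul Complex.I)
  have h' : HasFDerivAt (cgrad f) _ z := h
  rw [h'.fderiv]
  simp

lemma dbar_cgrad {f : ℂ → ℝ} {U : Set ℂ} (hU : IsOpen U) (hf : ContDiffOn ℝ 2 f U)
    {z : ℂ} (hz : z ∈ U) : dbar (cgrad f) z = lap f z := by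
  rw [dbar, hasFDerivAt_cgrad hU hf hz, hasFDerivAt_cgrad hU hf hz, lap,
    fderiv_fderiv_comm hU hf hz Complex.I 1]
  push_cast
  linear_combination (-(fderiv ℝ (fun w => fderiv ℝ f w Complex.I) z Complex.I : ℂ)) *
    Complex.I_mul_I

lemma dbar_ofReal {f : ℂ → ℝ} {z : ℂ} (hf : DifferentiableAt ℝ f z) :
    dbar (fun w => (f w : ℂ)) z = starRingEnd ℂ (cgrad f z) := by
  have h : HasFDerivAt (fun w => (f w : ℂ)) _ z :=
    Complex.ofRealCLM.hasFDerivAt.comp z hf.hasFDerivAt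
  rw [dbar, h.fderiv, cgrad]
  simp

lemma circCoeff_conj (h : ℂ → ℂ) (z₀ : ℂ) (ρ : ℝ) :
    circCoeff (fun z => starRingEnd ℂ (h z)) 0 z₀ ρ = starRingEnd ℂ (circCoeff h 0 z₀ ρ) := by
  simp only [circCoeff, Int.cast_zero, zero_mul, neg_zero, Complex.exp_zero, mul_one]
  rw [intervalIntegral.integral_of_le (by linarith [pi_pos]),
    intervalIntegral.integral_of_le (by linarith [pi_pos]), integral_conj]

/-- Interior gradient estimate for Poisson's equation. -/
lemma norm_cgrad_le {f : ℂ → ℝ} {U : Set ℂ} (hU : IsOpen U) (hf : ContDiffOn ℝ 2 f U)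
    {z₀ : ℂ} {R M S : ℝ} (hR0 : 0 < R) (hR : closedBall z₀ R ⊆ U)
    (hM : ∀ z ∈ closedBall z₀ R, |f z| ≤ M) (hS : ∀ z ∈ closedBall z₀ R, |lap f z| ≤ S) :
    ‖cgrad f z₀‖ ≤ 2 * M / R + S * R := by
  have hfd : ∀ z ∈ U, DifferentiableAt ℝ f z := fun z hz =>
    (hf.differentiableOn two_ne_zero).differentiableAt (hU.mem_nhds hz)
  have hg := contDiffOn_cgrad hU hf
  have hfc : ContDiffOn ℝ 1 (fun w => (f w : ℂ)) U :=
    Complex.ofRealCLM.contDiff.comp_contDiffOn (hf.of_le one_le_two)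
  have hc := continuousOn_circCoeff (-1) (hfc.continuousOn.mono hR)
  have hS0 : 0 ≤ S := (abs_nonneg _).trans (hS z₀ (mem_closedBall_self hR0.le))
  have hpi := pi_pos
  set w := starRingEnd ℂ (cgrad f z₀) with hw
  have hFc : ContinuousOn (fun x : ℝ => (x : ℂ) * circCoeff (fun w => (f w : ℂ)) (-1) z₀ x -
      π * x ^ 2 * w) (Set.Icc 0 R) := by
    refine ContinuousOn.sub (ContinuousOn.mul (by fun_prop) hc) (by fun_prop)
  have key := norm_sub_le_of_hasDerivAt_Ioo (B := fun x => π * S * x ^ 3)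
    (B' := fun x => π * S * (3 * x ^ 2)) hR0
    (hFc.mono Set.Ioc_subset_Icc_self)
    (fun x hx => by
      have h1 := hasDerivAt_circCoeff hU hfc hR (-1) hx
      have h2 : HasDerivAt (fun x : ℝ => (x : ℂ)) 1 x := Complex.ofRealCLM.hasDerivAt
      exact (h2.mul h1).sub (((h2.pow 2).const_mul (π : ℂ)).mul_const w))
    (by fun_prop)
    (fun x _ => by simpa using (hasDerivAt_pow 3 x).const_mul (π * S))
    (fun x hx => by
      have hx0 : (x : ℂ) ≠ 0 := by exact_mod_cast hx.1.ne'
      have hsub : closedBall z₀ x ⊆ closedBall z₀ R := closedBall_subset_closedBall hx.2.le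
      have e1 : circCoeff (dbar fun w => (f w : ℂ)) (-1 + 1) z₀ x =
          starRingEnd ℂ (circCoeff (cgrad f) 0 z₀ x) := by
        rw [← circCoeff_conj]
        refine intervalIntegral.integral_congr fun θ _ => ?_
        simp only [neg_add_cancel]
        rw [dbar_ofReal (hfd _ (hR (circleMap_mem_closedBall_of_le hx.1.le hx.2.le)))]
      have h3 := norm_circCoeff_zero_sub_le hU hg (hsub.trans hR) (S := S) (fun z hz => by
        rw [dbar_cgrad hU hf (hR (hsub hz)), Complex.norm_real]
        exact hS z (hsub hz)) hx.1.le
      have e2 : 1 * circCoeff (fun w => (f w : ℂ)) (-1) z₀ x + x * (((-1 : ℤ) *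
          circCoeff (fun w => (f w : ℂ)) (-1) z₀ x + x *
            circCoeff (dbar fun w => (f w : ℂ)) (-1 + 1) z₀ x) / x) -
          π * (((2 : ℕ) : ℂ) * (x : ℂ) ^ (2 - 1) * 1) * w =
          x * starRingEnd ℂ (circCoeff (cgrad f) 0 z₀ x - 2 * π * cgrad f z₀) := by
        rw [e1, mul_div_cancel₀ _ hx0, map_sub, map_mul, map_mul, Complex.conj_ofReal, ← hw,
          map_ofNat]
        simp
        ring
      rw [e2, norm_mul, Complex.norm_conj, Complex.norm_real, norm_of_nonneg hx.1.le]
      have := mul_le_mul_of_nonneg_left h3 hx.1.le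
      nlinarith [mul_nonneg (mul_nonneg hpi.le hS0) (sq_nonneg x)])
    (tendsto_zero_of_continuousOn_Icc hR0 hFc)
    (tendsto_zero_of_continuousOn_Icc (F := fun x => π * S * x ^ 3) hR0 (by fun_prop))
  simp only [Complex.ofReal_zero, zero_mul, ne_eq, OfNat.ofNat_ne_zero, not_false_eq_true,
    zero_pow, mul_zero, sub_zero] at key
  have h4 : ‖(R : ℂ) * circCoeff (fun w => (f w : ℂ)) (-1) z₀ R‖ ≤ R * (2 * π * M) := by
    rw [norm_mul, Complex.norm_real, norm_of_nonneg hR0.le]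
    refine mul_le_mul_of_nonneg_left (norm_circCoeff_le hR0.le fun z hz => ?_) hR0.le
    rw [Complex.norm_real]
    exact hM z (sphere_subset_closedBall hz)
  have h5 : ‖(π * R ^ 2 * w : ℂ)‖ = π * R ^ 2 * ‖cgrad f z₀‖ := by
    rw [norm_mul, hw, Complex.norm_conj, norm_mul, norm_pow, Complex.norm_real, Complex.norm_real,
      norm_of_nonneg hR0.le, norm_of_nonneg hpi.le]
  have h6 : ‖(π * R ^ 2 * w : ℂ)‖ ≤ R * (2 * π * M) + π * S * R ^ 3 := by
    have := norm_sub_norm_le (π * R ^ 2 * w : ℂ) ((R : ℂ) * circCoeff (fun w => (f w : ℂ)) (-1) z₀ R)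
    rw [norm_sub_rev] at this
    linarith
  rw [h5] at h6
  have h7 : ‖cgrad f z₀‖ * (π * R ^ 2) ≤ (2 * M / R + S * R) * (π * R ^ 2) := by
    have : (2 * M / R + S * R) * (π * R ^ 2) = R * (2 * π * M) + π * S * R ^ 3 := by
      field_simp
    rw [this]; linarith
  exact le_of_mul_le_mul_right h7 (by positivity)

lemma integral_fourier_factor {k : ℤ} (hk : k ≠ 0) :
    ∫ θ in -π..π, Complex.exp (-(k * θ * Complex.I)) = 0 := by
  have hc : (-(k * Complex.I) : ℂ) ≠ 0 := by simp [hk]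
  have : ∀ θ : ℝ, (-(k * θ * Complex.I) : ℂ) = -(k * Complex.I) * θ := fun θ => by ring
  simp only [this]
  rw [integral_exp_mul_complex hc]
  have e2 : Complex.exp (-(k * Complex.I) * (π : ℝ)) =
        Complex.exp (-(k * Complex.I) * ((-π : ℝ) : ℂ)) := by
      rw [Complex.exp_eq_exp_iff_exists_int]
      exact ⟨-k, by push_cast; ring⟩
  rw [e2, sub_self, zero_div]

lemma circCoeff_one_affine (c : ℂ) (L : ℂ →L[ℝ] ℂ) (z₀ : ℂ) (ρ : ℝ) :
    circCoeff (fun z => c + L (z - z₀)) 1 z₀ ρ = ρ * π * (L 1 - Complex.I * L Complex.I) := by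
  have hlin : ∀ v : ℂ, L v = v.re * L 1 + v.im * L Complex.I := by
    intro v
    have : v = v.re • (1 : ℂ) + v.im • Complex.I := by simp [Complex.re_add_im]
    conv_lhs => rw [this, map_add, map_smul, map_smul]
    simp
  have e : ∀ θ : ℝ, (c + L (circleMap z₀ ρ θ - z₀)) * Complex.exp (-((1 : ℤ) * θ * Complex.I)) =
      c * Complex.exp (-((1 : ℤ) * θ * Complex.I)) +
        ρ / 2 * (L 1 + Complex.I * L Complex.I) * Complex.exp (-((2 : ℤ) * θ * Complex.I)) +
          ρ / 2 * (L 1 - Complex.I * L Complex.I) := by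
    intro θ
    have h1 : circleMap z₀ ρ θ - z₀ = ρ • Complex.exp (θ * Complex.I) := by
      simp [circleMap]
    have h2 : Complex.exp (-((2 : ℤ) * θ * Complex.I)) =
        Complex.exp (-(θ * Complex.I)) * Complex.exp (-(θ * Complex.I)) := by
      rw [← Complex.exp_add]; congr 1; push_cast; ring
    have e6 : Complex.exp (-(θ * Complex.I)) = Real.cos θ - Real.sin θ * Complex.I := by
      have : (-(θ * Complex.I) : ℂ) = ((-θ : ℝ) : ℂ) * Complex.I := by push_cast; ring
      rw [this, Complex.exp_mul_I, ← Complex.ofReal_cos, ← Complex.ofReal_sin]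
      simp [sub_eq_add_neg]
    have e9 : ((Real.cos θ : ℂ)) ^ 2 + (Real.sin θ : ℂ) ^ 2 = 1 := by
      exact_mod_cast Real.cos_sq_add_sin_sq θ
    rw [h1, map_smul, hlin (Complex.exp _), h2, Complex.exp_ofReal_mul_I_re,
      Complex.exp_ofReal_mul_I_im, Complex.real_smul, Int.cast_one, one_mul, e6]
    linear_combination (ρ / 2 * (L 1 - Complex.I * L Complex.I) : ℂ) * e9 +
      (-(ρ : ℂ) / 2 * L 1 * (Real.sin θ : ℂ) ^ 2 -
        ρ / 2 * Complex.I * L Complex.I * (Real.sin θ : ℂ) ^ 2 +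
        ρ * L Complex.I * Real.cos θ * Real.sin θ) * Complex.I_mul_I
  simp only [circCoeff, e]
  rw [intervalIntegral.integral_add, intervalIntegral.integral_add,
    intervalIntegral.integral_const_mul, intervalIntegral.integral_const_mul,
    integral_fourier_factor one_ne_zero, integral_fourier_factor two_ne_zero,
    intervalIntegral.integral_const]
  · simp; ring
  all_goals exact Continuous.intervalIntegrable (by fun_prop) _ _

lemma circCoeff_sub {h g : ℂ → ℂ} (k : ℤ) {z₀ : ℂ} {ρ : ℝ} (hρ : 0 ≤ ρ)
    (hh : ContinuousOn h (closedBall z₀ ρ)) (hg : ContinuousOn g (closedBall z₀ ρ)) :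
    circCoeff (fun z => h z - g z) k z₀ ρ = circCoeff h k z₀ ρ - circCoeff g k z₀ ρ := by
  simp only [circCoeff, sub_mul]
  refine intervalIntegral.integral_sub ?_ ?_
  all_goals exact ((continuous_comp_circleMap (by assumption) hρ le_rfl).mul
    (by fun_prop)).intervalIntegrable _ _

lemma tendsto_circCoeff_one_div {h : ℂ → ℂ} {z₀ : ℂ} {R : ℝ} (hR : 0 < R)
    (hc : ContinuousOn h (closedBall z₀ R)) (hd : DifferentiableAt ℝ h z₀) :
    Filter.Tendsto (fun ρ : ℝ => circCoeff h 1 z₀ ρ / ρ) (nhdsWithin 0 (Set.Ioi 0))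
      (nhds (π * (fderiv ℝ h z₀ 1 - Complex.I * fderiv ℝ h z₀ Complex.I))) := by
  rw [Metric.tendsto_nhdsWithin_nhds]
  intro ε hε
  have hpi := pi_pos
  obtain ⟨δ, hδ, H⟩ := Metric.eventually_nhds_iff.mp
    ((hasFDerivAt_iff_isLittleO.mp hd.hasFDerivAt).def (c := ε / (4 * π)) (by positivity))
  refine ⟨min δ R, by positivity, fun ρ hρ hρδ => ?_⟩
  simp only [Set.mem_Ioi, dist_zero_right] at hρ hρδ
  rw [norm_of_nonneg hρ.le, lt_min_iff] at hρδ
  have hρ0 : (ρ : ℂ) ≠ 0 := by exact_mod_cast hρ.ne'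
  have h1 := circCoeff_sub (h := h) (g := fun z => h z₀ + fderiv ℝ h z₀ (z - z₀)) 1 hρ.le
    (hc.mono (closedBall_subset_closedBall hρδ.2.le)) (by fun_prop)
  have h2 := norm_circCoeff_le (h := fun z => h z - (h z₀ + fderiv ℝ h z₀ (z - z₀))) (k := 1)
    (z₀ := z₀) hρ.le (M := ε / (4 * π) * ρ) (fun z hz => by
      have := H (y := z) (by rw [mem_sphere.mp hz]; exact hρδ.1)
      rw [← dist_eq_norm z, mem_sphere.mp hz] at this
      simpa only [sub_add_eq_sub_sub] using this)
  rw [h1, circCoeff_one_affine] at h2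
  rw [dist_eq_norm]
  have h3 : circCoeff h 1 z₀ ρ / ρ - π * (fderiv ℝ h z₀ 1 - Complex.I * fderiv ℝ h z₀ Complex.I) =
      (circCoeff h 1 z₀ ρ - ρ * π * (fderiv ℝ h z₀ 1 - Complex.I * fderiv ℝ h z₀ Complex.I)) / ρ := by
    field_simp
  rw [h3, norm_div, Complex.norm_real, norm_of_nonneg hρ.le, div_lt_iff₀ hρ]
  refine h2.trans_lt ?_
  have : 2 * π * (ε / (4 * π) * ρ) = ε * ρ / 2 := by field_simp; ring
  rw [this]
  nlinarith [mul_pos hε hρ]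

lemma norm_wirtinger_le {h : ℂ → ℂ} {U : Set ℂ} (hU : IsOpen U) (hh : ContDiffOn ℝ 1 h U)
    {z₀ : ℂ} {R L Γ β : ℝ} (hR0 : 0 < R) (hβ : 0 < β) (hR : closedBall z₀ R ⊆ U)
    (hL : ∀ z ∈ closedBall z₀ R, ‖h z‖ ≤ L)
    (hΓ : ∀ z ∈ closedBall z₀ R, ‖dbar h z‖ ≤ Γ * ‖z - z₀‖ ^ β) :
    ‖fderiv ℝ h z₀ 1 - Complex.I * fderiv ℝ h z₀ Complex.I‖ ≤ 2 * L / R + 2 * Γ * R ^ β / β := by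
  have hpi := pi_pos
  have hc := continuousOn_circCoeff 1 (hh.continuousOn.mono hR)
  have hcB : ContinuousOn (fun x : ℝ => 2 * π * Γ / β * x ^ β) (Set.Icc 0 R) :=
    (continuous_const.mul (continuous_id.rpow_const fun _ => Or.inr hβ.le)).continuousOn
  have key := norm_sub_le_of_hasDerivAt_Ioo (F := fun ρ : ℝ => circCoeff h 1 z₀ ρ / ρ)
    (B := fun x => 2 * π * Γ / β * x ^ β) (B' := fun x => 2 * π * Γ / β * (β * x ^ (β - 1))) hR0
    (ContinuousOn.div (hc.mono Set.Ioc_subset_Icc_self) (by fun_prop) fun x hx => by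
      exact_mod_cast hx.1.ne')
    (fun x hx => by
      have h2 : HasDerivAt (fun x : ℝ => (x : ℂ)) 1 x := Complex.ofRealCLM.hasDerivAt
      exact (hasDerivAt_circCoeff hU hh hR 1 hx).div h2 (by exact_mod_cast hx.1.ne'))
    (hcB.mono Set.Ioc_subset_Icc_self)
    (fun x hx => (Real.hasDerivAt_rpow_const (Or.inl hx.1.ne')).const_mul _)
    (fun x hx => by
      have hx0 : (x : ℂ) ≠ 0 := by exact_mod_cast hx.1.ne'
      have e : (((1 : ℤ) * circCoeff h 1 z₀ x + x * circCoeff (dbar h) (1 + 1) z₀ x) / x * x -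
          circCoeff h 1 z₀ x * 1) / (x : ℂ) ^ 2 = circCoeff (dbar h) (1 + 1) z₀ x / x := by
        field_simp; push_cast; ring
      rw [e, norm_div, Complex.norm_real, norm_of_nonneg hx.1.le, div_le_iff₀ hx.1]
      refine (norm_circCoeff_le hx.1.le (M := Γ * x ^ β) fun z hz => ?_).trans (le_of_eq ?_)
      · have := hΓ z (closedBall_subset_closedBall hx.2.le (sphere_subset_closedBall hz))
        rwa [← dist_eq_norm, mem_sphere.mp hz] at this
      · rw [Real.rpow_sub_one hx.1.ne']
        have := hx.1.ne'
        field_simp)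
    (tendsto_circCoeff_one_div hR0 (hh.continuousOn.mono hR)
      ((hh.differentiableOn one_ne_zero).differentiableAt
        (hU.mem_nhds (hR (mem_closedBall_self hR0.le)))))
    (tendsto_zero_of_continuousOn_Icc hR0 hcB)
  rw [Real.zero_rpow hβ.ne', mul_zero, sub_zero] at key
  set D := fderiv ℝ h z₀ 1 - Complex.I * fderiv ℝ h z₀ Complex.I
  have h4 : ‖circCoeff h 1 z₀ R / R‖ ≤ 2 * π * L / R := by
    rw [norm_div, Complex.norm_real, norm_of_nonneg hR0.le]
    gcongr
    exact norm_circCoeff_le hR0.le fun z hz => hL z (sphere_subset_closedBall hz)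
  have h5 := norm_sub_norm_le (π * D : ℂ) (circCoeff h 1 z₀ R / R)
  rw [norm_sub_rev, norm_mul, Complex.norm_real, norm_of_nonneg hpi.le] at h5
  have h6 : π * ‖D‖ ≤ π * (2 * L / R + 2 * Γ * R ^ β / β) := by
    have : π * (2 * L / R + 2 * Γ * R ^ β / β) = 2 * π * L / R + 2 * π * Γ / β * R ^ β := by
      field_simp
    rw [this]; linarith
  exact le_of_mul_le_mul_left h6 hpi

/-- Second derivative estimate at the center for Poisson's equation with a right-hand side that is
Hölder continuous at the center. -/
lemma second_derivative_le {f : ℂ → ℝ} {U : Set ℂ} (hU : IsOpen U) (hf : ContDiffOn ℝ 2 f U)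
    {z₀ : ℂ} {R L S Γ β : ℝ} (hR0 : 0 < R) (hR1 : R ≤ 1) (hβ : 0 < β) (hR : closedBall z₀ R ⊆ U)
    (hL : ∀ z ∈ closedBall z₀ R, ‖cgrad f z‖ ≤ L) (hS : |lap f z₀| ≤ S)
    (hΓ : ∀ z ∈ closedBall z₀ R, |lap f z - lap f z₀| ≤ Γ * ‖z - z₀‖ ^ β) :
    |fderiv ℝ (fun w => fderiv ℝ f w 1) z₀ 1 - fderiv ℝ (fun w => fderiv ℝ f w Complex.I) z₀
        Complex.I| ≤ 2 * (L + S) / R + 2 * Γ * R ^ β / β ∧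
      2 * |fderiv ℝ (fun w => fderiv ℝ f w 1) z₀ Complex.I| ≤
        2 * (L + S) / R + 2 * Γ * R ^ β / β := by
  set c : ℂ := (lap f z₀ : ℂ) / 2 with hc
  set h : ℂ → ℂ := fun z => cgrad f z - c * starRingEnd ℂ (z - z₀) with hdef
  have hz₀ : z₀ ∈ U := hR (mem_closedBall_self hR0.le)
  have hg := contDiffOn_cgrad hU hf
  have hconj : ContDiff ℝ 1 fun z : ℂ => c * starRingEnd ℂ (z - z₀) :=
    contDiff_const.mul (Complex.conjCLE.contDiff.comp (contDiff_id.sub contDiff_const))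
  have hh : ContDiffOn ℝ 1 h U := hg.sub hconj.contDiffOn
  have hder : ∀ z ∈ U, ∀ v, fderiv ℝ h z v = fderiv ℝ (cgrad f) z v - c * starRingEnd ℂ v := by
    intro z hz v
    have h1 := ((hg.differentiableOn one_ne_zero).differentiableAt (hU.mem_nhds hz)).hasFDerivAt
    have h2 : HasFDerivAt (fun z : ℂ => c * starRingEnd ℂ (z - z₀)) _ z :=
      (Complex.conjCLE.hasFDerivAt.comp z ((hasFDerivAt_id z).sub_const z₀)).const_mul c
    have h3 : HasFDerivAt h _ z := h1.sub h2
    rw [h3.fderiv]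
    simp
  have hS0 : 0 ≤ S := (abs_nonneg _).trans hS
  have hdbar : ∀ z ∈ U, dbar h z = ((lap f z - lap f z₀ : ℝ) : ℂ) := by
    intro z hz
    rw [dbar, hder z hz, hder z hz]
    have := dbar_cgrad hU hf hz
    rw [dbar] at this
    push_cast
    rw [← this, Complex.conj_I, map_one (starRingEnd ℂ), hc]
    linear_combination (lap f z₀ / 2 : ℂ) * Complex.I_mul_I
  have key := norm_wirtinger_le hU hh hR0 hβ hR (L := L + S)
    (fun z hz => by
      refine (norm_sub_le _ _).trans (add_le_add (hL z hz) ?_)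
      rw [norm_mul, Complex.norm_conj, hc, norm_div, Complex.norm_real, Complex.norm_ofNat,
        Real.norm_eq_abs]
      have h1 : ‖z - z₀‖ ≤ 1 := by rw [← dist_eq_norm]; exact (mem_closedBall.mp hz).trans hR1
      have := mul_le_mul_of_nonneg_left h1 (abs_nonneg (lap f z₀))
      nlinarith [abs_nonneg (lap f z₀)])
    (fun z hz => by
      rw [hdbar z (hR hz), Complex.norm_real]; exact hΓ z hz)
  rw [hder z₀ hz₀, hder z₀ hz₀, hasFDerivAt_cgrad hU hf hz₀, hasFDerivAt_cgrad hU hf hz₀,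
    Complex.conj_I, map_one (starRingEnd ℂ), fderiv_fderiv_comm hU hf hz₀ Complex.I 1] at key
  set p := fderiv ℝ (fun w => fderiv ℝ f w 1) z₀ 1
  set q := fderiv ℝ (fun w => fderiv ℝ f w 1) z₀ Complex.I
  set s := fderiv ℝ (fun w => fderiv ℝ f w Complex.I) z₀ Complex.I
  have e : (p - Complex.I * q - c * 1 - Complex.I * (q - Complex.I * s - c * -Complex.I) : ℂ) =
      ((p - s : ℝ) : ℂ) + ((-2 * q : ℝ) : ℂ) * Complex.I := by
    push_cast
    linear_combination (s - c : ℂ) * Complex.I_mul_I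
  rw [e] at key
  constructor
  · refine le_trans ?_ ((Complex.abs_re_le_norm _).trans key)
    simp
  · refine le_trans ?_ ((Complex.abs_im_le_norm _).trans key)
    simp [abs_mul]

lemma cgrad_sub_const (f : ℂ → ℝ) (c : ℝ) : cgrad (fun z => f z - c) = cgrad f := by
  funext z; simp [cgrad, fderiv_sub_const]

lemma lap_sub_const (f : ℂ → ℝ) (c : ℝ) : lap (fun z => f z - c) = lap f := by
  funext z; simp [lap, fderiv_sub_const]

/-- Heinz's interior gradient bound: quadratic growth of the Laplacian and small oscillation. -/
lemma norm_cgrad_le_of_small_oscillation {f : ℂ → ℝ} {U : Set ℂ} (hU : IsOpen U)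
    (hf : ContDiffOn ℝ 2 f U) {z₀ : ℂ} {R C M c : ℝ} (hR0 : 0 < R) (hR : closedBall z₀ R ⊆ U)
    (hC : 0 < C) (hCM : 32 * C * M < 1)
    (hlap : ∀ z ∈ closedBall z₀ R, |lap f z| ≤ C * ‖cgrad f z‖ ^ 2)
    (hM : ∀ z ∈ closedBall z₀ R, |f z - c| ≤ M) :
    C * (R * ‖cgrad f z₀‖) ≤ 1 / 4 := by
  have hg := contDiffOn_cgrad hU hf
  have hz₀ := mem_closedBall_self (x := z₀) hR0.le
  obtain ⟨w, hw, hmax⟩ := (isCompact_closedBall z₀ R).exists_isMaxOn ⟨z₀, hz₀⟩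
    (f := fun z => (R - ‖z - z₀‖) * ‖cgrad f z‖)
    (ContinuousOn.mul (by fun_prop) (hg.continuousOn.mono hR).norm)
  set m := (R - ‖w - z₀‖) * ‖cgrad f w‖ with hm
  have hm0 : R * ‖cgrad f z₀‖ ≤ m := by simpa using hmax hz₀
  suffices C * m < 1 / 4 from ((mul_le_mul_of_nonneg_left hm0 hC.le).trans this.le)
  by_contra! hcon
  have hmpos : 0 < m := by
    by_contra! h
    nlinarith
  set d := R - ‖w - z₀‖ with hd
  have hwR : ‖w - z₀‖ ≤ R := by rw [← dist_eq_norm]; exact hw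
  have hdpos : 0 < d := by
    rcases (sub_nonneg.mpr hwR).eq_or_lt with h | h
    · rw [hm, hd, ← h, zero_mul] at hmpos; exact absurd hmpos (lt_irrefl _)
    · exact h
  have hCm : 0 < C * m := by positivity
  set s := d / (8 * (C * m)) with hs
  have hspos : 0 < s := by positivity
  have hsd : s ≤ d / 2 := by
    rw [hs]; gcongr; linarith
  have hdist : ∀ z ∈ closedBall w s, ‖z - z₀‖ ≤ R - d / 2 := fun z hz => by
    have h1 : ‖z - w‖ ≤ s := by rw [← dist_eq_norm]; exact hz
    have h2 : ‖z - z₀‖ ≤ ‖z - w‖ + ‖w - z₀‖ := by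
      simpa using norm_add_le (z - w) (w - z₀)
    linarith
  have hsub : closedBall w s ⊆ closedBall z₀ R := fun z hz => by
    rw [mem_closedBall, dist_eq_norm]; linarith [hdist z hz]
  have key := norm_cgrad_le hU (f := fun z => f z - c) (hf.sub contDiffOn_const) hspos
    (hsub.trans hR) (M := M) (S := C * (2 * m / d) ^ 2) (fun z hz => hM z (hsub hz))
    (fun z hz => by
      rw [lap_sub_const]
      refine (hlap z (hsub hz)).trans ?_
      gcongr
      rw [le_div_iff₀ hdpos]
      have h1 : (R - ‖z - z₀‖) * ‖cgrad f z‖ ≤ m := hmax (hsub hz)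
      have h2 := hdist z hz
      nlinarith [norm_nonneg (cgrad f z)])
  rw [cgrad_sub_const] at key
  have h1 : ‖cgrad f w‖ = m / d := by rw [hm]; field_simp
  have h2 : 2 * M / s + C * (2 * m / d) ^ 2 * s = (16 * C * M + 1 / 2) * (m / d) := by
    rw [hs]; field_simp; ring
  rw [h1, h2] at key
  have h3 : 0 < m / d := by positivity
  nlinarith

lemma lintegral_polar (u : ℂ → ENNReal) (hu : Measurable u) (z₀ : ℂ) :
    ∫⁻ z, u z = ∫⁻ ρ in Set.Ioi (0 : ℝ), ∫⁻ θ in Set.Ioo (-π) π,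
      ENNReal.ofReal ρ * u (circleMap z₀ ρ θ) := by
  rw [← MeasureTheory.lintegral_add_left_eq_self u z₀, ← Complex.lintegral_comp_polarCoord_symm,
    polarCoord_target, MeasureTheory.Measure.volume_eq_prod,
    ← MeasureTheory.Measure.prod_restrict, MeasureTheory.lintegral_prod]
  · refine MeasureTheory.lintegral_congr fun ρ => MeasureTheory.lintegral_congr fun θ => ?_
    simp [circleMap, Complex.exp_mul_I]
  · refine Measurable.aemeasurable ?_
    simp only [Complex.polarCoord_symm_apply, smul_eq_mul]
    fun_prop

lemma measurable_indicator_ofReal {q : ℂ → ℝ} {s : Set ℂ} (hs : MeasurableSet s)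
    (hq : ContinuousOn q s) : Measurable (s.indicator fun z => ENNReal.ofReal (q z)) := by
  classical
  rw [← Set.piecewise_eq_indicator]
  exact (ENNReal.continuous_ofReal.comp_continuousOn hq).measurable_piecewise
    continuousOn_const hs

lemma circleMap_mem_ball_iff {z₀ : ℂ} {ρ R θ : ℝ} (hρ : 0 ≤ ρ) :
    circleMap z₀ ρ θ ∈ ball z₀ R ↔ ρ < R := by
  rw [mem_ball, mem_sphere.mp (circleMap_mem_sphere z₀ hρ θ)]

lemma lintegral_ball_polar {q : ℂ → ℝ} {z₀ : ℂ} {R : ℝ} (hq : ContinuousOn q (closedBall z₀ R))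
    (hq0 : ∀ z ∈ closedBall z₀ R, 0 ≤ q z) :
    ∫⁻ z in ball z₀ R, ENNReal.ofReal (q z) =
      ∫⁻ ρ in Set.Ioo 0 R, ENNReal.ofReal (ρ * ∫ θ in -π..π, q (circleMap z₀ ρ θ)) := by
  rw [← MeasureTheory.lintegral_indicator measurableSet_ball,
    lintegral_polar _ (measurable_indicator_ofReal measurableSet_ball
      (hq.mono ball_subset_closedBall)) z₀,
    ← Set.Ioi_inter_Iio (a := (0 : ℝ)) (b := R), Set.inter_comm, ← MeasureTheory.setLIntegral_indicator measurableSet_Iio]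
  refine MeasureTheory.setLIntegral_congr_fun measurableSet_Ioi fun ρ hρ => ?_
  have hρ0 : 0 ≤ ρ := le_of_lt hρ
  by_cases h : ρ < R
  · rw [Set.indicator_of_mem (by exact h)]
    have e : ∀ θ : ℝ, ENNReal.ofReal ρ * (ball z₀ R).indicator (fun z => ENNReal.ofReal (q z))
        (circleMap z₀ ρ θ) = ENNReal.ofReal ρ * ENNReal.ofReal (q (circleMap z₀ ρ θ)) := fun θ => by
      rw [Set.indicator_of_mem ((circleMap_mem_ball_iff hρ0).mpr h)]
    simp only [e]
    have hc := continuous_comp_circleMap hq hρ0 h.le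
    rw [MeasureTheory.lintegral_const_mul' _ _ ENNReal.ofReal_ne_top, ENNReal.ofReal_mul hρ0,
      intervalIntegral.integral_of_le (by linarith [pi_pos]),
      MeasureTheory.integral_Ioc_eq_integral_Ioo,
      ← MeasureTheory.ofReal_integral_eq_lintegral_ofReal]
    · exact (hc.integrableOn_Icc).mono_set Set.Ioo_subset_Icc_self
    · exact Filter.Eventually.of_forall fun θ => hq0 _ (circleMap_mem_closedBall_of_le hρ0 h.le)
  · rw [Set.indicator_of_notMem (by exact h)]
    have e : ∀ θ : ℝ, ENNReal.ofReal ρ * (ball z₀ R).indicator (fun z => ENNReal.ofReal (q z))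
        (circleMap z₀ ρ θ) = 0 := fun θ => by
      rw [Set.indicator_of_notMem (by rwa [circleMap_mem_ball_iff hρ0]), mul_zero]
    simp [e]

lemma fderiv_eq_re_cgrad (f : ℂ → ℝ) (z v : ℂ) : fderiv ℝ f z v = (cgrad f z * v).re := by
  have : v = v.re • (1 : ℂ) + v.im • Complex.I := by simp [Complex.re_add_im]
  conv_lhs => rw [this, map_add, map_smul, map_smul]
  simp [cgrad]
  ring

lemma abs_fderiv_le (f : ℂ → ℝ) (z v : ℂ) : |fderiv ℝ f z v| ≤ ‖cgrad f z‖ * ‖v‖ := by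
  rw [fderiv_eq_re_cgrad, ← norm_mul]; exact Complex.abs_re_le_norm _

lemma sq_integral_le {g : ℝ → ℝ} (hg : Continuous g) :
    (∫ θ in -π..π, g θ) ^ 2 ≤ 2 * π * ∫ θ in -π..π, g θ ^ 2 := by
  have hpi := pi_pos
  set I := ∫ θ in -π..π, g θ with hI
  have h0 : 0 ≤ ∫ θ in -π..π, (g θ - I / (2 * π)) ^ 2 :=
    intervalIntegral.integral_nonneg (by linarith) fun _ _ => sq_nonneg _
  have e : ∀ θ, (g θ - I / (2 * π)) ^ 2 = g θ ^ 2 - (2 * (I / (2 * π))) * g θ +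
      (I / (2 * π)) ^ 2 := fun θ => by ring
  simp only [e] at h0
  rw [intervalIntegral.integral_add, intervalIntegral.integral_sub,
    intervalIntegral.integral_const_mul, intervalIntegral.integral_const, ← hI] at h0
  · have : 2 * π * ((∫ θ in -π..π, g θ ^ 2) - 2 * (I / (2 * π)) * I +
        (π - -π) • (I / (2 * π)) ^ 2) = 2 * π * (∫ θ in -π..π, g θ ^ 2) - I ^ 2 := by
      rw [smul_eq_mul]; field_simp; ring
    have := mul_nonneg (by positivity : 0 ≤ 2 * π) h0
    linarith
  all_goals exact Continuous.intervalIntegrable (by fun_prop) _ _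

lemma exists_circleMap_eq {z₀ z : ℂ} {ρ : ℝ} (h : ‖z - z₀‖ = ρ) :
    ∃ θ ∈ Set.Icc (-π) π, circleMap z₀ ρ θ = z := by
  refine ⟨Complex.arg (z - z₀), ⟨(Complex.neg_pi_lt_arg _).le, Complex.arg_le_pi _⟩, ?_⟩
  rw [circleMap, ← h, Complex.norm_mul_exp_arg_mul_I]; ring

lemma exists_circle_ge {f : ℂ → ℝ} {z₀ : ℂ} {ρ : ℝ} (hf : ContinuousOn f (closedBall z₀ ρ))
    (hcrit : ∀ z ∈ closedBall z₀ ρ, cgrad f z ≠ 0) {z : ℂ} (hz : z ∈ closedBall z₀ ρ) :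
    ∃ θ ∈ Set.Icc (-π) π, f z ≤ f (circleMap z₀ ρ θ) := by
  obtain ⟨w, hw, hmax⟩ := (isCompact_closedBall z₀ ρ).exists_isMaxOn ⟨z, hz⟩ hf
  have hw' : ‖w - z₀‖ = ρ := by
    rw [← dist_eq_norm]
    refine le_antisymm hw (not_lt.mp fun hlt => ?_)
    have hloc : IsLocalMax f w := hmax.isLocalMax
      (Filter.mem_of_superset (isOpen_ball.mem_nhds hlt) ball_subset_closedBall)
    exact hcrit w hw (by simp [cgrad, hloc.fderiv_eq_zero])
  obtain ⟨θ, hθ, e⟩ := exists_circleMap_eq hw'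
  exact ⟨θ, hθ, e ▸ hmax hz⟩

lemma cgrad_neg (f : ℂ → ℝ) (z : ℂ) : cgrad (fun w => -f w) z = -cgrad f z := by
  simp [cgrad, fderiv_fun_neg]; ring

lemma sub_le_integral_circle {f : ℂ → ℝ} {U : Set ℂ} (hU : IsOpen U) (hf : ContDiffOn ℝ 2 f U)
    {z₀ : ℂ} {ρ : ℝ} (hρ : 0 ≤ ρ) (hR : closedBall z₀ ρ ⊆ U) {s t : ℝ}
    (hs : s ∈ Set.Icc (-π) π) (ht : t ∈ Set.Icc (-π) π) :
    f (circleMap z₀ ρ s) - f (circleMap z₀ ρ t) ≤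
      ρ * ∫ θ in -π..π, ‖cgrad f (circleMap z₀ ρ θ)‖ := by
  have hpi := pi_pos
  have hd : ∀ θ : ℝ, HasDerivAt (fun θ => f (circleMap z₀ ρ θ))
      (fderiv ℝ f (circleMap z₀ ρ θ) (circleMap 0 ρ θ * Complex.I)) θ := fun θ =>
    (((hf.differentiableOn two_ne_zero).differentiableAt (hU.mem_nhds
      (hR (circleMap_mem_closedBall z₀ hρ θ)))).hasFDerivAt).comp_hasDerivAt θ
        (hasDerivAt_circleMap z₀ ρ θ)
  have hD : ContinuousOn (fderiv ℝ f) (closedBall z₀ ρ) :=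
    (hf.continuousOn_fderiv_of_isOpen hU one_le_two).mono hR
  have hc : Continuous fun θ => fderiv ℝ f (circleMap z₀ ρ θ) (circleMap 0 ρ θ * Complex.I) :=
    (continuous_comp_circleMap hD hρ le_rfl).clm_apply
      ((continuous_circleMap _ _).mul continuous_const)
  have hcg : Continuous fun θ => ‖cgrad f (circleMap z₀ ρ θ)‖ :=
    (continuous_comp_circleMap ((contDiffOn_cgrad hU hf).continuousOn.mono hR) hρ le_rfl).norm
  have hb : ∀ θ, ‖fderiv ℝ f (circleMap z₀ ρ θ) (circleMap 0 ρ θ * Complex.I)‖ ≤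
      ρ * ‖cgrad f (circleMap z₀ ρ θ)‖ := fun θ => by
    refine (abs_fderiv_le _ _ _).trans (le_of_eq ?_)
    rw [norm_mul, norm_circleMap_zero, Complex.norm_I, mul_one, abs_of_nonneg hρ, mul_comm]
  rw [← intervalIntegral.integral_eq_sub_of_hasDerivAt (fun θ _ => hd θ)
    (hc.intervalIntegrable _ _), ← intervalIntegral.integral_const_mul]
  refine (le_abs_self _).trans ?_
  refine (intervalIntegral.norm_integral_le_integral_norm_uIoc (μ := MeasureTheory.volume)
    (f := fun θ => fderiv ℝ f (circleMap z₀ ρ θ) (circleMap 0 ρ θ * Complex.I))).trans ?_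
  rw [intervalIntegral.integral_of_le (by linarith)]
  have hsub : Set.uIoc t s ⊆ Set.Ioc (-π) π := by
    intro x hx
    rw [Set.mem_uIoc] at hx
    rcases hx with hx | hx
    · exact ⟨ht.1.trans_lt hx.1, hx.2.trans hs.2⟩
    · exact ⟨hs.1.trans_lt hx.1, hx.2.trans ht.2⟩
  have hfi : MeasureTheory.IntegrableOn (fun θ => ρ * ‖cgrad f (circleMap z₀ ρ θ)‖)
      (Set.Ioc (-π) π) := ((continuous_const.mul hcg).integrableOn_Icc).mono_set
        Set.Ioc_subset_Icc_self
  refine (MeasureTheory.setIntegral_mono_on ?_ (hfi.mono_set hsub) measurableSet_uIoc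
    fun θ _ => hb θ).trans ?_
  · exact (hc.norm.integrableOn_Icc (a := -π) (b := π)).mono_set
      (hsub.trans Set.Ioc_subset_Icc_self)
  · exact MeasureTheory.setIntegral_mono_set hfi
      (Filter.Eventually.of_forall fun θ => by positivity) hsub.eventuallyLE

lemma sq_sub_le_circle {f : ℂ → ℝ} {U : Set ℂ} (hU : IsOpen U) (hf : ContDiffOn ℝ 2 f U)
    {z₀ : ℂ} {ρ : ℝ} (hρ : 0 ≤ ρ) (hR : closedBall z₀ ρ ⊆ U) (hcrit : ∀ z ∈ U, cgrad f z ≠ 0)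
    {z : ℂ} (hz : z ∈ closedBall z₀ ρ) :
    (f z - f z₀) ^ 2 ≤ 2 * π * ρ ^ 2 * ∫ θ in -π..π, ‖cgrad f (circleMap z₀ ρ θ)‖ ^ 2 := by
  have hz₀ := mem_closedBall_self (x := z₀) hρ
  have hup : ∀ a ∈ closedBall z₀ ρ, ∀ b ∈ closedBall z₀ ρ,
      f a - f b ≤ ρ * ∫ θ in -π..π, ‖cgrad f (circleMap z₀ ρ θ)‖ := by
    intro a ha b hb
    have hfc := hf.continuousOn.mono hR
    obtain ⟨s, hs, h1⟩ := exists_circle_ge hfc (fun z hz => hcrit z (hR hz)) ha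
    obtain ⟨t, ht, h2⟩ := exists_circle_ge (f := fun z => -f z) hfc.neg
      (fun z hz => by rw [cgrad_neg]; exact neg_ne_zero.mpr (hcrit z (hR hz))) hb
    have := sub_le_integral_circle hU hf hρ hR hs ht
    linarith
  have habs : |f z - f z₀| ≤ ρ * ∫ θ in -π..π, ‖cgrad f (circleMap z₀ ρ θ)‖ :=
    abs_sub_le_iff.mpr ⟨hup z hz z₀ hz₀, hup z₀ hz₀ z hz⟩
  have hcg : Continuous fun θ => ‖cgrad f (circleMap z₀ ρ θ)‖ :=
    (continuous_comp_circleMap ((contDiffOn_cgrad hU hf).continuousOn.mono hR) hρ le_rfl).norm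
  rw [← sq_abs]
  calc |f z - f z₀| ^ 2 ≤ (ρ * ∫ θ in -π..π, ‖cgrad f (circleMap z₀ ρ θ)‖) ^ 2 := by gcongr
    _ = ρ ^ 2 * (∫ θ in -π..π, ‖cgrad f (circleMap z₀ ρ θ)‖) ^ 2 := by ring
    _ ≤ ρ ^ 2 * (2 * π * ∫ θ in -π..π, ‖cgrad f (circleMap z₀ ρ θ)‖ ^ 2) := by
      gcongr; exact sq_integral_le hcg
    _ = _ := by ring

/-- Logarithmic modulus of continuity for functions without critical points. -/
lemma sq_sub_mul_log_le {f : ℂ → ℝ} {U : Set ℂ} (hU : IsOpen U) (hf : ContDiffOn ℝ 2 f U)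
    {z₀ : ℂ} {R δ E : ℝ} (hδ : 0 < δ) (hδR : δ < R) (hE : 0 ≤ E) (hR : closedBall z₀ R ⊆ U)
    (hcrit : ∀ z ∈ U, cgrad f z ≠ 0)
    (hfi : ∫⁻ z in ball z₀ R, ENNReal.ofReal (‖cgrad f z‖ ^ 2) ≤ ENNReal.ofReal E)
    {z : ℂ} (hz : z ∈ closedBall z₀ δ) :
    (f z - f z₀) ^ 2 * log (R / δ) ≤ 2 * π * E := by
  have hpi := pi_pos
  have hcg : ContinuousOn (fun z => ‖cgrad f z‖ ^ 2) (closedBall z₀ R) :=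
    ((contDiffOn_cgrad hU hf).continuousOn.mono hR).norm.pow 2
  rw [lintegral_ball_polar hcg fun _ _ => sq_nonneg _] at hfi
  set c := (f z - f z₀) ^ 2 / (2 * π) with hc
  have hc0 : 0 ≤ c := by positivity
  have hii : IntervalIntegrable (fun x : ℝ => c * x⁻¹) MeasureTheory.volume δ R :=
    ContinuousOn.intervalIntegrable (by
      rw [Set.uIcc_of_le hδR.le]
      exact continuousOn_const.mul (continuousOn_id.inv₀ fun x hx => (hδ.trans_le hx.1).ne'))
  have h1 : ENNReal.ofReal (c * log (R / δ)) = ∫⁻ ρ in Set.Ioc δ R, ENNReal.ofReal (c * ρ⁻¹) := by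
    rw [← integral_inv_of_pos hδ (hδ.trans hδR), ← intervalIntegral.integral_const_mul,
      intervalIntegral.integral_of_le hδR.le, MeasureTheory.ofReal_integral_eq_lintegral_ofReal]
    · exact (intervalIntegrable_iff_integrableOn_Ioc_of_le hδR.le).mp hii
    · refine (MeasureTheory.ae_restrict_iff' measurableSet_Ioc).mpr
        (Filter.Eventually.of_forall fun x hx => ?_)
      have : 0 < x := hδ.trans hx.1
      change 0 ≤ c * x⁻¹
      positivity
  have h2 : ∫⁻ ρ in Set.Ioc δ R, ENNReal.ofReal (c * ρ⁻¹) ≤ ENNReal.ofReal E := by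
    rw [MeasureTheory.setLIntegral_congr (MeasureTheory.Ioo_ae_eq_Ioc (a := δ) (b := R)).symm]
    refine le_trans ?_ hfi
    refine le_trans (MeasureTheory.setLIntegral_mono' measurableSet_Ioo fun ρ hρ => ?_)
      (MeasureTheory.lintegral_mono_set (Set.Ioo_subset_Ioo_left hδ.le))
    have hρ0 : 0 < ρ := hδ.trans hρ.1
    refine ENNReal.ofReal_le_ofReal ?_
    have := sq_sub_le_circle hU hf hρ0.le ((closedBall_subset_closedBall hρ.2.le).trans hR) hcrit
      (closedBall_subset_closedBall hρ.1.le hz)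
    rw [hc, ← div_eq_mul_inv, div_div, div_le_iff₀ (by positivity)]
    refine this.trans (le_of_eq ?_)
    ring
  rw [← h1, ENNReal.ofReal_le_ofReal_iff hE, hc] at h2
  have h3 : (f z - f z₀) ^ 2 * log (R / δ) = 2 * π * ((f z - f z₀) ^ 2 / (2 * π) * log (R / δ)) := by
    field_simp
  rw [h3]; gcongr

lemma exists_contDiffOn_log {h : ℂ → ℂ} {z₀ : ℂ} {T : ℝ} (hT : 0 < T)
    (hh : ContDiffOn ℝ 1 h (ball z₀ T)) (h0 : ∀ z ∈ ball z₀ T, h z ≠ 0) :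
    ∃ p : ℂ → ℂ, ContDiffOn ℝ 1 p (ball z₀ T) ∧ ∀ z ∈ ball z₀ T, Complex.exp (p z) = h z := by
  have hsc : IsSimplyConnected (ball z₀ T) := by
    have := (convex_ball z₀ T).contractibleSpace ⟨z₀, mem_ball_self hT⟩
    have : SimplyConnectedSpace (ball z₀ T) := inferInstance
    exact this
  obtain ⟨p, hp, hpe⟩ := Complex.exists_continuousOn_eqOn_exp_comp hsc isOpen_ball
    hh.continuousOn (by rintro ⟨z, hz, hz0⟩; exact h0 z hz hz0)
  refine ⟨p, fun z hz => ?_, hpe⟩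
  have hpz : ContinuousAt p z := hp.continuousAt (isOpen_ball.mem_nhds hz)
  have hev : ∀ᶠ w in nhds z, p w = p z + Complex.log (h w / h z) := by
    have h1 : ∀ᶠ w in nhds z, ‖p w - p z‖ < π := by
      have : ContinuousAt (fun w => ‖p w - p z‖) z := (hpz.sub continuousAt_const).norm
      exact this.eventually_lt continuousAt_const (by simpa using pi_pos)
    filter_upwards [h1, isOpen_ball.mem_nhds hz] with w hw hwb
    have him := (Complex.abs_im_le_norm (p w - p z)).trans_lt hw
    rw [abs_lt] at him
    rw [← hpe hwb, ← hpe hz]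
    simp only [Function.comp]
    rw [← Complex.exp_sub, Complex.log_exp him.1 him.2.le]
    ring
  have hc : ContDiffAt ℝ 1 (fun w => p z + Complex.log (h w / h z)) z := by
    refine contDiffAt_const.add ?_
    refine ContDiffAt.comp z (g := Complex.log) (f := fun w => h w / h z) ?_ ?_
    · refine ContDiffAt.restrict_scalars ℝ (Complex.contDiffAt_log ?_)
      rw [div_self (h0 z hz)]
      exact Complex.one_mem_slitPlane
    · simp only [div_eq_mul_inv]
      exact (hh.contDiffAt (isOpen_ball.mem_nhds hz)).mul contDiffAt_const
  exact (hc.congr_of_eventuallyEq hev).contDiffWithinAt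

lemma dbar_log {h p : ℂ → ℂ} {U : Set ℂ} (hU : IsOpen U) (hp : ContDiffOn ℝ 1 p U)
    (he : ∀ z ∈ U, Complex.exp (p z) = h z) {z : ℂ} (hz : z ∈ U) :
    dbar h z = h z * dbar p z := by
  have hd : HasFDerivAt p (fderiv ℝ p z) z :=
    ((hp.differentiableOn one_ne_zero).differentiableAt (hU.mem_nhds hz)).hasFDerivAt
  have h1 := hd.cexp
  have h2 : HasFDerivAt h (Complex.exp (p z) • fderiv ℝ p z) z :=
    h1.congr_of_eventuallyEq (by
      filter_upwards [hU.mem_nhds hz] with w hw using (he w hw).symm)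
  simp only [dbar, h2.fderiv, ← he z hz]
  simp
  ring

lemma abs_integral_circle_re_sub_le {p : ℂ → ℂ} {U : Set ℂ} (hU : IsOpen U)
    (hp : ContDiffOn ℝ 1 p U) {z₀ : ℂ} {R S : ℝ} (hR0 : 0 ≤ R) (hR : closedBall z₀ R ⊆ U)
    (hS : ∀ z ∈ closedBall z₀ R, ‖dbar p z‖ ≤ S) (c : ℝ) :
    |(∫ θ in -π..π, (c - (p (circleMap z₀ R θ)).re)) - 2 * π * (c - (p z₀).re)| ≤
      2 * π * S * R := by
  have hcont := continuous_comp_circleMap (hp.continuousOn.mono hR) hR0 le_rfl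
  have h1 := norm_circCoeff_zero_sub_le hU hp hR hS hR0
  refine le_trans ?_ ((Complex.abs_re_le_norm _).trans h1)
  have h2 : (circCoeff p 0 z₀ R).re = ∫ θ in -π..π, (p (circleMap z₀ R θ)).re := by
    have := Complex.reCLM.intervalIntegral_comp_comm
      (hcont.intervalIntegrable (μ := MeasureTheory.volume) (-π) π)
    simp only [Complex.reCLM_apply] at this
    rw [this]
    simp [circCoeff]
  have h3 : Continuous fun θ => (p (circleMap z₀ R θ)).re := Complex.continuous_re.comp hcont
  rw [Complex.sub_re, h2, intervalIntegral.integral_sub intervalIntegrable_const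
    (h3.intervalIntegrable _ _), intervalIntegral.integral_const]
  rw [abs_sub_comm]
  apply le_of_eq
  congr 1
  simp
  ring

lemma lintegral_Ioo_ofReal_mul {c R : ℝ} (hc : 0 ≤ c) (hR : 0 ≤ R) :
    ∫⁻ ρ in Set.Ioo 0 R, ENNReal.ofReal (c * ρ) = ENNReal.ofReal (c * R ^ 2 / 2) := by
  have hi : MeasureTheory.IntegrableOn (fun ρ : ℝ => c * ρ) (Set.Ioo 0 R) :=
    ((continuous_const.mul continuous_id).integrableOn_Icc).mono_set Set.Ioo_subset_Icc_self
  rw [← MeasureTheory.ofReal_integral_eq_lintegral_ofReal hi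
    ((MeasureTheory.ae_restrict_mem measurableSet_Ioo).mono fun ρ hρ => mul_nonneg hc hρ.1.le),
    ← MeasureTheory.integral_Ioc_eq_integral_Ioo, ← intervalIntegral.integral_of_le hR,
    intervalIntegral.integral_const_mul, integral_id]
  congr 1; ring

lemma log_harnack_step {p : ℂ → ℂ} {U : Set ℂ} (hU : IsOpen U)
    (hp : ContDiffOn ℝ 1 p U) {z₀ z₁ : ℂ} {R S c : ℝ} (hR0 : 0 < R) (hR : closedBall z₀ R ⊆ U)
    (hS : ∀ z ∈ closedBall z₀ R, ‖dbar p z‖ ≤ S)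
    (hc : ∀ z ∈ closedBall z₀ R, (p z).re ≤ c) (hz : ‖z₁ - z₀‖ ≤ R / 2) :
    c - (p z₁).re ≤ 4 * (c - (p z₀).re) + 5 * S * R := by
  have hpi := pi_pos
  have hS0 : 0 ≤ S := (norm_nonneg _).trans (hS z₀ (mem_closedBall_self hR0.le))
  have hq0 := hc z₀ (mem_closedBall_self hR0.le)
  have hsub : closedBall z₁ (R / 2) ⊆ closedBall z₀ R := by
    refine closedBall_subset_closedBall' ?_
    rw [dist_eq_norm]; linarith
  by_cases hq1 : c - (p z₁).re - S * R / 2 ≤ 0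
  · nlinarith [mul_nonneg hS0 hR0.le]
  push Not at hq1
  have hcont : ContinuousOn (fun z => c - (p z).re) U :=
    continuousOn_const.sub (Complex.continuous_re.comp_continuousOn hp.continuousOn)
  have hle : ∫⁻ z in ball z₁ (R / 2), ENNReal.ofReal (c - (p z).re) ≤
      ∫⁻ z in ball z₀ R, ENNReal.ofReal (c - (p z).re) := by
    refine MeasureTheory.lintegral_mono_set (ball_subset_ball' ?_)
    rw [dist_eq_norm]; linarith
  rw [lintegral_ball_polar (hcont.mono (hsub.trans hR)) fun z hz => sub_nonneg.mpr (hc z (hsub hz)),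
    lintegral_ball_polar (hcont.mono hR) fun z hz => sub_nonneg.mpr (hc z hz)] at hle
  have hlow : ENNReal.ofReal (2 * π * (c - (p z₁).re - S * R / 2) * (R / 2) ^ 2 / 2) ≤
      ∫⁻ ρ in Set.Ioo 0 (R / 2),
        ENNReal.ofReal (ρ * ∫ θ in -π..π, (c - (p (circleMap z₁ ρ θ)).re)) := by
    rw [← lintegral_Ioo_ofReal_mul (by positivity) (by positivity)]
    refine MeasureTheory.setLIntegral_mono' measurableSet_Ioo fun ρ hρ => ENNReal.ofReal_le_ofReal ?_
    have hs := (closedBall_subset_closedBall hρ.2.le).trans hsub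
    have := (abs_le.mp (abs_integral_circle_re_sub_le hU hp hρ.1.le (hs.trans hR)
      (fun z hz => hS z (hs hz)) c)).1
    have h2 : 2 * π * S * ρ ≤ 2 * π * S * (R / 2) :=
      mul_le_mul_of_nonneg_left hρ.2.le (by positivity)
    rw [mul_comm]
    exact mul_le_mul_of_nonneg_left (by linarith) hρ.1.le
  have hupp : ∫⁻ ρ in Set.Ioo 0 R,
      ENNReal.ofReal (ρ * ∫ θ in -π..π, (c - (p (circleMap z₀ ρ θ)).re)) ≤
      ENNReal.ofReal (2 * π * (c - (p z₀).re + S * R) * R ^ 2 / 2) := by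
    have h0 : 0 ≤ c - (p z₀).re := sub_nonneg.mpr hq0
    rw [← lintegral_Ioo_ofReal_mul (by positivity) (by positivity)]
    refine MeasureTheory.setLIntegral_mono' measurableSet_Ioo fun ρ hρ => ENNReal.ofReal_le_ofReal ?_
    have hs := closedBall_subset_closedBall (x := z₀) hρ.2.le
    have := (abs_le.mp (abs_integral_circle_re_sub_le hU hp hρ.1.le (hs.trans hR)
      (fun z hz => hS z (hs hz)) c)).2
    have h2 : 2 * π * S * ρ ≤ 2 * π * S * R :=
      mul_le_mul_of_nonneg_left hρ.2.le (by positivity)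
    rw [mul_comm _ ρ]
    exact mul_le_mul_of_nonneg_left (by linarith) hρ.1.le
  have hfin := (hlow.trans hle).trans hupp
  have h0 : 0 ≤ c - (p z₀).re := sub_nonneg.mpr hq0
  rw [ENNReal.ofReal_le_ofReal_iff (by positivity)] at hfin
  have h3 : (c - (p z₁).re - S * R / 2) * (π * R ^ 2 / 4) ≤
      (4 * (c - (p z₀).re + S * R)) * (π * R ^ 2 / 4) := by nlinarith
  have h4 := le_of_mul_le_mul_right h3 (by positivity)
  nlinarith [mul_nonneg hS0 hR0.le]

/-- A Harnack chain for non-vanishing solutions of `|∂̄h| ≤ S|h|`. -/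
lemma norm_lower_bound {h : ℂ → ℂ} {T' T R S L m : ℝ} {w₁ : ℂ} {n : ℕ} (hT : T < T')
    (hh : ContDiffOn ℝ 1 h (ball 0 T')) (h0 : ∀ z ∈ ball 0 T', h z ≠ 0) (hR0 : 0 < R)
    (hS0 : 0 ≤ S)
    (hS : ∀ z ∈ closedBall 0 T, ‖dbar h z‖ ≤ S * ‖h z‖) (hL : ∀ z ∈ closedBall 0 T, ‖h z‖ ≤ L)
    (hw : ‖w₁‖ + R ≤ T) (hn : ‖w₁‖ ≤ n * (R / 2)) (hm0 : 0 < m) (hm : m ≤ ‖h w₁‖) :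
    L * exp (-(4 ^ n * (log (L / m) + 2 * S * R))) ≤ ‖h 0‖ := by
  have hTT : closedBall (0 : ℂ) T ⊆ ball 0 T' := closedBall_subset_ball hT
  have hw0 := norm_nonneg w₁
  have hT0 : 0 < T' := by linarith
  obtain ⟨p, hp, hpe⟩ := exists_contDiffOn_log hT0 hh h0
  have hnorm : ∀ z ∈ ball 0 T', ‖h z‖ = exp (p z).re := fun z hz => by
    rw [← hpe z hz, Complex.norm_exp]
  have hw1 : w₁ ∈ closedBall 0 T := by rw [mem_closedBall_zero_iff]; linarith
  have hL0 : 0 < L := by linarith [hL w₁ hw1]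
  have hre : ∀ z ∈ closedBall 0 T, (p z).re ≤ log L := fun z hz => by
    rw [le_log_iff_exp_le hL0, ← hnorm z (hTT hz)]; exact hL z hz
  have hdb : ∀ z ∈ closedBall 0 T, ‖dbar p z‖ ≤ S := fun z hz => by
    have h1 := hS z hz
    have h2 := norm_pos_iff.mpr (h0 z (hTT hz))
    rw [dbar_log isOpen_ball hp hpe (hTT hz), norm_mul, mul_comm] at h1
    exact le_of_mul_le_mul_right h1 h2
  have key : ∀ k : ℕ, k ≤ n → log L - (p (((1 - k / n : ℝ) : ℂ) * w₁)).re + 2 * S * R ≤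
      4 ^ k * (log L - (p w₁).re + 2 * S * R) := by
    intro k
    induction k with
    | zero => intro _; simp
    | succ k ih =>
      intro hk
      have hn0 : (0 : ℝ) < n := by exact_mod_cast (by omega : 0 < n)
      have hkn : (k : ℝ) ≤ n := by exact_mod_cast (by omega : k ≤ n)
      have hdiv : (k : ℝ) / n ≤ 1 := (div_le_one hn0).mpr hkn
      have hdiv0 : 0 ≤ (k : ℝ) / n := by positivity
      have hsub : closedBall (((1 - k / n : ℝ) : ℂ) * w₁) R ⊆ closedBall 0 T := by
        refine closedBall_subset_closedBall' ?_
        rw [dist_zero_right, norm_mul, Complex.norm_real, Real.norm_of_nonneg (by linarith)]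
        nlinarith
      have := log_harnack_step isOpen_ball hp (c := log L) hR0 (hsub.trans hTT)
        (fun z hz => hdb z (hsub hz)) (fun z hz => hre z (hsub hz))
        (z₁ := ((1 - (k + 1 : ℕ) / n : ℝ) : ℂ) * w₁) (by
          rw [← sub_mul, ← Complex.ofReal_sub, norm_mul, Complex.norm_real, Real.norm_eq_abs]
          have : (1 - ((k + 1 : ℕ) : ℝ) / n) - (1 - k / n) = -(1 / n) := by push_cast; ring
          rw [this, abs_neg, abs_of_pos (by positivity), one_div, inv_mul_le_iff₀ hn0]
          exact hn)
      have hk' := ih (by omega)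
      have hSR := mul_nonneg hS0 hR0.le
      rw [pow_succ]
      nlinarith
  have hfin := key n le_rfl
  have hz : ((1 - n / n : ℝ) : ℂ) * w₁ = 0 := by
    rcases Nat.eq_zero_or_pos n with rfl | hn'
    · have : ‖w₁‖ ≤ 0 := by simpa using hn
      simp [norm_le_zero_iff.mp this]
    · rw [div_self (by exact_mod_cast hn'.ne')]; simp
  rw [hz] at hfin
  have hlogm : log m ≤ (p w₁).re := by
    rw [← Real.log_exp (p w₁).re, ← hnorm w₁ (hTT hw1)]
    exact log_le_log hm0 hm
  rw [hnorm 0 (by simpa using hT0)]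
  rw [log_div hL0.ne' hm0.ne']
  calc L * exp (-(4 ^ n * (log L - log m + 2 * S * R)))
      = exp (log L - 4 ^ n * (log L - log m + 2 * S * R)) := by
        rw [sub_eq_add_neg (log L) (4 ^ n * _), exp_add, exp_log hL0]
    _ ≤ exp (p 0).re := by
        refine exp_le_exp.mpr ?_
        have h1 : (4 : ℝ) ^ n * (log L - (p w₁).re + 2 * S * R) ≤
            4 ^ n * (log L - log m + 2 * S * R) :=
          mul_le_mul_of_nonneg_left (by linarith) (by positivity)
        nlinarith [mul_nonneg hS0 hR0.le]

lemma lintegral_ray_ge {F : Type*} [NormedAddCommGroup F] [NormedSpace ℝ F] {Y : ℂ → F}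
    {W : ℂ → ℝ} {ε : ℝ} {e : ℂ} (he : ‖e‖ = 1)
    (hY : DifferentiableOn ℝ Y (ball 0 1))
    (hW : ∀ z ∈ ball (0 : ℂ) 1, ∀ v, ‖fderiv ℝ Y z v‖ ^ 2 = W z * ‖v‖ ^ 2)
    (hlen : 1 ≤ ∫ t in (0 : ℝ)..1, ‖deriv (fun t : ℝ => Y (t • e)) t‖)
    (hε0 : 0 < ε) (hε : ε ≤ 1 / 2)
    (hsmall : ∀ z : ℂ, ‖z‖ ≤ 1 - ε → W z ≤ 1 / 4) :
    ENNReal.ofReal (1 / (4 * ε)) ≤ ∫⁻ t in Set.Ioo (1 - ε) 1, ENNReal.ofReal (W (t • e)) := by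
  have hmem : ∀ t ∈ Set.Ioo (0 : ℝ) 1, t • e ∈ ball (0 : ℂ) 1 := fun t ht => by
    rw [mem_ball_zero_iff, norm_smul, he, mul_one, Real.norm_of_nonneg ht.1.le]; exact ht.2
  have hg : ∀ t ∈ Set.Ioo (0 : ℝ) 1, ‖deriv (fun t : ℝ => Y (t • e)) t‖ ^ 2 = W (t • e) := by
    intro t ht
    have h1 : HasDerivAt (fun t : ℝ => t • e) e t := by
      simpa using (hasDerivAt_id t).smul_const e
    have h2 := ((hY.differentiableAt (isOpen_ball.mem_nhds (hmem t ht))).hasFDerivAt).comp_hasDerivAt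
      t h1
    have h3 : deriv (fun t : ℝ => Y (t • e)) t = fderiv ℝ Y (t • e) e := h2.deriv
    rw [h3, hW _ (hmem t ht), he]; ring
  set g := fun t : ℝ => ‖deriv (fun t : ℝ => Y (t • e)) t‖ with hgdef
  have hfi : IntervalIntegrable g MeasureTheory.volume 0 1 := by
    by_contra h
    rw [intervalIntegral.integral_undef h] at hlen
    linarith
  have h1 : (1 - ε) ∈ Set.uIcc (0 : ℝ) 1 := by
    rw [Set.uIcc_of_le zero_le_one]; constructor <;> linarith
  have hi1 := hfi.mono_set (Set.uIcc_subset_uIcc_left h1)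
  have hi2 := hfi.mono_set (Set.uIcc_subset_uIcc_right h1)
  rw [← intervalIntegral.integral_add_adjacent_intervals hi1 hi2] at hlen
  have hfirst : ∫ t in (0 : ℝ)..(1 - ε), g t ≤ 1 / 2 := by
    have := intervalIntegral.integral_mono_on_of_le_Ioo (by linarith) hi1
      (intervalIntegrable_const (c := (1 / 2 : ℝ))) fun t ht => by
        have h2 := hg t ⟨ht.1, by linarith [ht.2]⟩
        have h3 := hsmall (t • e) (by
          rw [norm_smul, he, mul_one, Real.norm_of_nonneg ht.1.le]; exact ht.2.le)
        have : g t ^ 2 ≤ (1 / 2) ^ 2 := by rw [hgdef]; simp only; rw [h2]; linarith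
        exact (sq_le_sq₀ (norm_nonneg _) (by norm_num)).mp this
    rw [intervalIntegral.integral_const] at this
    refine this.trans ?_
    simp; linarith
  have hsec : 1 / 2 ≤ ∫ t in (1 - ε)..1, g t := by linarith
  rw [intervalIntegral.integral_of_le (by linarith), MeasureTheory.integral_Ioc_eq_integral_Ioo]
    at hsec
  have hlow : ENNReal.ofReal (1 / 2) ≤ ∫⁻ t in Set.Ioo (1 - ε) 1, ENNReal.ofReal (g t) := by
    rw [← MeasureTheory.ofReal_integral_eq_lintegral_ofReal]
    · exact ENNReal.ofReal_le_ofReal hsec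
    · exact ((intervalIntegrable_iff_integrableOn_Ioc_of_le (by linarith)).mp hi2).mono_set
        Set.Ioo_subset_Ioc_self
    · exact Filter.Eventually.of_forall fun t => norm_nonneg _
  have hup : ∫⁻ t in Set.Ioo (1 - ε) 1, ENNReal.ofReal (g t) ≤
      ∫⁻ t in Set.Ioo (1 - ε) 1, (ENNReal.ofReal (1 / (4 * ε)) +
        ENNReal.ofReal ε * ENNReal.ofReal (W (t • e))) := by
    refine MeasureTheory.setLIntegral_mono' measurableSet_Ioo fun t ht => ?_
    have h2 := hg t ⟨by linarith [ht.1], ht.2⟩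
    rw [← h2, ← ENNReal.ofReal_mul hε0.le, ← ENNReal.ofReal_add (by positivity) (by positivity)]
    refine ENNReal.ofReal_le_ofReal ?_
    have h3 : 1 / (4 * ε) + ε * g t ^ 2 - g t = ε * (g t - 1 / (2 * ε)) ^ 2 := by
      field_simp; ring
    have : 0 ≤ ε * (g t - 1 / (2 * ε)) ^ 2 := by positivity
    change g t ≤ _ + ε * g t ^ 2
    linarith
  rw [MeasureTheory.lintegral_add_left measurable_const, MeasureTheory.setLIntegral_const,
    MeasureTheory.lintegral_const_mul' _ _ ENNReal.ofReal_ne_top, Real.volume_Ioo,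
    ← ENNReal.ofReal_mul (by positivity)] at hup
  have h4 := hlow.trans hup
  set J := ∫⁻ t in Set.Ioo (1 - ε) 1, ENNReal.ofReal (W (t • e)) with hJ
  by_cases hJt : J = ⊤
  · rw [hJt]; exact le_top
  rw [← ENNReal.ofReal_toReal hJt] at h4 ⊢
  rw [← ENNReal.ofReal_mul hε0.le, ← ENNReal.ofReal_add (by
    apply mul_nonneg; positivity; linarith) (by positivity),
    ENNReal.ofReal_le_ofReal_iff (by
      apply add_nonneg; apply mul_nonneg; positivity; linarith; positivity)] at h4
  refine ENNReal.ofReal_le_ofReal ?_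
  have h5 : 1 / (4 * ε) * (1 - (1 - ε)) = 1 / 4 := by field_simp; ring
  rw [h5] at h4
  rw [div_le_iff₀ (by positivity)]
  linarith

/-- A surface containing a geodesic disc of radius one cannot have small area element away
from the boundary. -/
lemma exists_area_element_ge {F : Type*} [NormedAddCommGroup F] [NormedSpace ℝ F] {Y : ℂ → F}
    {W : ℂ → ℝ} {E : ℝ} (hE0 : 0 ≤ E)
    (hY : DifferentiableOn ℝ Y (ball 0 1)) (hWc : ContinuousOn W (ball 0 1))
    (hW : ∀ z ∈ ball (0 : ℂ) 1, ∀ v, ‖fderiv ℝ Y z v‖ ^ 2 = W z * ‖v‖ ^ 2)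
    (hE : ∫⁻ z in ball (0 : ℂ) 1, ENNReal.ofReal (W z) ≤ ENNReal.ofReal E)
    (hlen : ∀ e : ℂ, ‖e‖ = 1 → 1 ≤ ∫ t in (0 : ℝ)..1, ‖deriv (fun t : ℝ => Y (t • e)) t‖) :
    ∃ w₁ : ℂ, ‖w₁‖ ≤ 1 - 1 / (2 * (E + 1)) ∧ 1 / 4 ≤ W w₁ := by
  by_contra! hcon
  have hpi := pi_pos
  set ε := 1 / (2 * (E + 1)) with hεdef
  have hε0 : 0 < ε := by positivity
  have hε : ε ≤ 1 / 2 := by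
    rw [hεdef, div_le_div_iff₀ (by positivity) (by norm_num)]; linarith
  set u : ℂ → ENNReal := (ball (0 : ℂ) 1).indicator fun z => ENNReal.ofReal (W z) with hu
  have hum : Measurable u := measurable_indicator_ofReal measurableSet_ball hWc
  rw [← MeasureTheory.lintegral_indicator measurableSet_ball, lintegral_polar _ hum 0,
    MeasureTheory.lintegral_lintegral_swap (by
      refine Measurable.aemeasurable ?_
      have : Measurable fun p : ℝ × ℝ => circleMap 0 p.1 p.2 := by
        unfold circleMap; fun_prop
      exact (ENNReal.measurable_ofReal.comp measurable_fst).mul (hum.comp this))] at hE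
  have hlow : ∀ θ : ℝ, ENNReal.ofReal (1 / 2) * ENNReal.ofReal (1 / (4 * ε)) ≤
      ∫⁻ ρ in Set.Ioi (0 : ℝ), ENNReal.ofReal ρ * u (circleMap 0 ρ θ) := by
    intro θ
    have he : ‖Complex.exp (θ * Complex.I)‖ = 1 := Complex.norm_exp_ofReal_mul_I θ
    refine le_trans (mul_le_mul_right (lintegral_ray_ge he hY hW (hlen _ he) hε0 hε
      fun z hz => (hcon z hz).le) _) ?_
    rw [← MeasureTheory.lintegral_const_mul' _ _ ENNReal.ofReal_ne_top]
    refine le_trans ?_ (MeasureTheory.lintegral_mono_set (s := Set.Ioo (1 - ε) 1)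
      fun t ht => by
        have := ht.1
        change 0 < t
        linarith)
    refine MeasureTheory.setLIntegral_mono' measurableSet_Ioo fun t ht => ?_
    have ht0 : 1 / 2 ≤ t := by linarith [ht.1]
    have hc : circleMap 0 t θ = t • Complex.exp (θ * Complex.I) := by simp [circleMap]
    rw [hu, Set.indicator_of_mem ((circleMap_mem_ball_iff (by linarith)).mpr ht.2), hc]
    gcongr
  have h1 := (MeasureTheory.setLIntegral_mono' (measurableSet_Ioo (a := -π) (b := π))
    fun θ _ => hlow θ).trans hE
  rw [MeasureTheory.setLIntegral_const, Real.volume_Ioo, ← ENNReal.ofReal_mul (by norm_num),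
    ← ENNReal.ofReal_mul (by positivity), ENNReal.ofReal_le_ofReal_iff hE0] at h1
  have h2 : 1 / 2 * (1 / (4 * ε)) * (π - -π) = π * (E + 1) / 2 := by
    rw [hεdef]; field_simp; ring
  rw [h2] at h1
  nlinarith [pi_gt_three]

section PrescribedMeanCurvature

variable {F : Type*} [NormedAddCommGroup F] [InnerProductSpace ℝ F]

/-- The normal projection `W h - ⟪h, p⟫ p - ⟪h, q⟫ q`, scaled by `W`, of `h`, where `p`, `q` are
orthogonal with `‖p‖² = ‖q‖² = W`. -/
def scaledNormal (W : ℝ) (h p q : F) : F := W • h - ⟪h, p⟫ • p - ⟪h, q⟫ • q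

/-- `Y` is a conformally parametrized immersion of the unit disc with area element `W` and
mean curvature vector the normal part of `H`. -/
structure IsConformalPMC (Y : ℂ → F) (W : ℂ → ℝ) (H : F → F) : Prop where
  contDiffOn : ContDiffOn ℝ 2 Y (ball 0 1)
  norm_one : ∀ z ∈ ball (0 : ℂ) 1, ‖fderiv ℝ Y z 1‖ ^ 2 = W z
  norm_I : ∀ z ∈ ball (0 : ℂ) 1, ‖fderiv ℝ Y z Complex.I‖ ^ 2 = W z
  inner_eq_zero : ∀ z ∈ ball (0 : ℂ) 1, ⟪fderiv ℝ Y z 1, fderiv ℝ Y z Complex.I⟫ = 0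
  pos : ∀ z ∈ ball (0 : ℂ) 1, 0 < W z
  laplacian : ∀ z ∈ ball (0 : ℂ) 1,
    fderiv ℝ (fun w => fderiv ℝ Y w 1) z 1 + fderiv ℝ (fun w => fderiv ℝ Y w Complex.I) z Complex.I
      = (2 : ℝ) • scaledNormal (W z) (H (Y z)) (fderiv ℝ Y z 1) (fderiv ℝ Y z Complex.I)

lemma norm_scaledNormal_le {W A : ℝ} {h p q : F} (hA : ‖h‖ ≤ A) (hp : ‖p‖ ^ 2 = W)
    (hq : ‖q‖ ^ 2 = W) : ‖scaledNormal W h p q‖ ≤ 3 * A * W := by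
  have hW : 0 ≤ W := hp ▸ sq_nonneg _
  have key : ∀ p : F, ‖p‖ ^ 2 = W → ‖⟪h, p⟫ • p‖ ≤ A * W := fun p hp => by
    rw [norm_smul, Real.norm_eq_abs]
    calc |⟪h, p⟫| * ‖p‖ ≤ (‖h‖ * ‖p‖) * ‖p‖ := by gcongr; exact abs_real_inner_le_norm h p
      _ = ‖h‖ * W := by rw [← hp]; ring
      _ ≤ A * W := by gcongr
  have h1 : ‖W • h‖ ≤ A * W := by
    rw [norm_smul, Real.norm_of_nonneg hW, mul_comm]; gcongr
  calc ‖scaledNormal W h p q‖ ≤ ‖W • h‖ + ‖⟪h, p⟫ • p‖ + ‖⟪h, q⟫ • q‖ :=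
        (norm_sub_le _ _).trans (add_le_add_left (norm_sub_le _ _) _)
    _ ≤ 3 * A * W := by linarith [key p hp, key q hq]

lemma norm_inner_smul_sub_le {A L η δ : ℝ} {h h' p p' : F} (hA : ‖h'‖ ≤ A) (hp : ‖p‖ ≤ L)
    (hp' : ‖p'‖ ≤ L) (hη : ‖h - h'‖ ≤ η) (hδ : ‖p - p'‖ ≤ δ) :
    ‖⟪h, p⟫ • p - ⟪h', p'⟫ • p'‖ ≤ η * L ^ 2 + 2 * A * L * δ := by
  have hA0 := (norm_nonneg _).trans hA
  have hL0 := (norm_nonneg _).trans hp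
  have hη0 := (norm_nonneg _).trans hη
  have hδ0 := (norm_nonneg _).trans hδ
  have e : ⟪h, p⟫ • p - ⟪h', p'⟫ • p' =
      ⟪h - h', p⟫ • p + ⟪h', p - p'⟫ • p + ⟪h', p'⟫ • (p - p') := by
    rw [inner_sub_left, inner_sub_right]; module
  rw [e]
  have h1 : ‖⟪h - h', p⟫ • p‖ ≤ (η * L) * L := by
    rw [norm_smul]
    exact mul_le_mul ((norm_inner_le_norm _ _).trans (by gcongr)) hp (norm_nonneg _) (by positivity)
  have h2 : ‖⟪h', p - p'⟫ • p‖ ≤ (A * δ) * L := by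
    rw [norm_smul]
    exact mul_le_mul ((norm_inner_le_norm _ _).trans (by gcongr)) hp (norm_nonneg _) (by positivity)
  have h3 : ‖⟪h', p'⟫ • (p - p')‖ ≤ (A * L) * δ := by
    rw [norm_smul]
    exact mul_le_mul ((norm_inner_le_norm _ _).trans (by gcongr)) hδ (norm_nonneg _) (by positivity)
  linarith [norm_add₃_le (a := ⟪h - h', p⟫ • p) (b := ⟪h', p - p'⟫ • p)
    (c := ⟪h', p'⟫ • (p - p'))]

lemma norm_scaledNormal_sub_le {W W' A L η δ : ℝ} {h h' p p' q q' : F} (hA : ‖h'‖ ≤ A)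
    (hpW : ‖p‖ ^ 2 = W) (hpW' : ‖p'‖ ^ 2 = W')
    (hp : ‖p‖ ≤ L) (hp' : ‖p'‖ ≤ L) (hq : ‖q‖ ≤ L) (hq' : ‖q'‖ ≤ L) (hη : ‖h - h'‖ ≤ η)
    (hδp : ‖p - p'‖ ≤ δ) (hδq : ‖q - q'‖ ≤ δ) :
    ‖scaledNormal W h p q - scaledNormal W' h' p' q'‖ ≤ 3 * (η * L ^ 2 + 2 * A * L * δ) := by
  have hA0 := (norm_nonneg _).trans hA
  have hL0 := (norm_nonneg _).trans hp
  have hη0 := (norm_nonneg _).trans hη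
  have hδ0 := (norm_nonneg _).trans hδp
  have e : scaledNormal W h p q - scaledNormal W' h' p' q' = (W • h - W' • h')
      - (⟪h, p⟫ • p - ⟪h', p'⟫ • p') - (⟪h, q⟫ • q - ⟪h', q'⟫ • q') := by
    unfold scaledNormal; abel
  have h1 : ‖W • h - W' • h'‖ ≤ η * L ^ 2 + 2 * A * L * δ := by
    have e : W • h - W' • h' = W • (h - h') + (W - W') • h' := by module
    have h2 : ‖W • (h - h')‖ ≤ L ^ 2 * η := by
      rw [norm_smul, ← hpW, Real.norm_of_nonneg (sq_nonneg _)]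
      gcongr
    have h3 : ‖(W - W') • h'‖ ≤ (δ * (2 * L)) * A := by
      rw [norm_smul]
      refine mul_le_mul ?_ hA (norm_nonneg _) (by positivity)
      rw [← hpW, ← hpW', Real.norm_eq_abs, sq_sub_sq, abs_mul, mul_comm]
      refine mul_le_mul ((abs_norm_sub_norm_le _ _).trans hδp) ?_ (abs_nonneg _) hδ0
      rw [abs_of_nonneg (by positivity)]; linarith
    rw [e]
    linarith [norm_add_le (W • (h - h')) ((W - W') • h')]
  rw [e]
  have h2 := norm_inner_smul_sub_le hA hp hp' hη hδp
  have h3 := norm_inner_smul_sub_le hA hq hq' hη hδq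
  linarith [norm_sub_le ((W • h - W' • h') - (⟪h, p⟫ • p - ⟪h', p'⟫ • p'))
    (⟪h, q⟫ • q - ⟪h', q'⟫ • q'), norm_sub_le (W • h - W' • h') (⟪h, p⟫ • p - ⟪h', p'⟫ • p')]

section Coordinate

variable {Y : ℂ → F} {U : Set ℂ}

lemma contDiffOn_inner_const (hY : ContDiffOn ℝ 2 Y U) (e : F) :
    ContDiffOn ℝ 2 (fun w => ⟪e, Y w⟫) U := contDiffOn_const.inner ℝ hY

lemma fderiv_inner_const {G : Type*} [NormedAddCommGroup G] [NormedSpace ℝ G] {Y : G → F} {z : G}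
    (hY : DifferentiableAt ℝ Y z) (e : F) (v : G) :
    fderiv ℝ (fun w => ⟪e, Y w⟫) z v = ⟪e, fderiv ℝ Y z v⟫ := by
  have := ((innerSL ℝ e).hasFDerivAt.comp z hY.hasFDerivAt).fderiv
  have h2 : (⇑(innerSL ℝ e) ∘ Y) = fun w => ⟪e, Y w⟫ := by funext w; simp
  rw [h2] at this
  rw [this]; simp

lemma fderiv_fderiv_inner_const (hU : IsOpen U) (hY : ContDiffOn ℝ 2 Y U) {z : ℂ} (hz : z ∈ U)
    (e : F) (v w : ℂ) :
    fderiv ℝ (fun x => fderiv ℝ (fun w => ⟪e, Y w⟫) x v) z w =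
      ⟪e, fderiv ℝ (fun x => fderiv ℝ Y x v) z w⟫ := by
  have h1 : (fun x => fderiv ℝ (fun w => ⟪e, Y w⟫) x v) =ᶠ[nhds z]
      fun x => ⟪e, fderiv ℝ Y x v⟫ := by
    filter_upwards [hU.mem_nhds hz] with x hx
    exact fderiv_inner_const ((hY.differentiableOn two_ne_zero).differentiableAt (hU.mem_nhds hx)) e v
  rw [h1.fderiv_eq]
  exact fderiv_inner_const (((contDiffOn_fderiv_apply hU hY v).differentiableOn
    one_ne_zero).differentiableAt (hU.mem_nhds hz)) e w

lemma lap_inner_const (hU : IsOpen U) (hY : ContDiffOn ℝ 2 Y U) {z : ℂ} (hz : z ∈ U) (e : F) :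
    lap (fun w => ⟪e, Y w⟫) z = ⟪e, fderiv ℝ (fun w => fderiv ℝ Y w 1) z 1 +
      fderiv ℝ (fun w => fderiv ℝ Y w Complex.I) z Complex.I⟫ := by
  rw [lap, fderiv_fderiv_inner_const hU hY hz, fderiv_fderiv_inner_const hU hY hz, inner_add_right]

lemma norm_cgrad_sq (f : ℂ → ℝ) (z : ℂ) :
    ‖cgrad f z‖ ^ 2 = fderiv ℝ f z 1 ^ 2 + fderiv ℝ f z Complex.I ^ 2 := by
  rw [← Complex.normSq_eq_norm_sq, Complex.normSq_apply]
  simp [cgrad]; ring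

lemma norm_cgrad_inner_const_sq {z : ℂ} (hY : DifferentiableAt ℝ Y z) (e : F) :
    ‖cgrad (fun w => ⟪e, Y w⟫) z‖ ^ 2 =
      ⟪e, fderiv ℝ Y z 1⟫ ^ 2 + ⟪e, fderiv ℝ Y z Complex.I⟫ ^ 2 := by
  rw [norm_cgrad_sq, fderiv_inner_const hY, fderiv_inner_const hY]

end Coordinate

lemma norm_cgrad_le_of_energy {f : ℂ → ℝ} {C E η : ℝ} {z₀ : ℂ} (hC : 0 < C) (hE : 0 ≤ E)
    (hη : 0 < η) (hz : ‖z₀‖ + η < 1) (hf : ContDiffOn ℝ 2 f (ball 0 1))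
    (hcrit : ∀ z ∈ ball (0 : ℂ) 1, cgrad f z ≠ 0)
    (hlap : ∀ z ∈ ball (0 : ℂ) 1, |lap f z| ≤ C * ‖cgrad f z‖ ^ 2)
    (hfi : ∫⁻ z in ball (0 : ℂ) 1, ENNReal.ofReal (‖cgrad f z‖ ^ 2) ≤ ENNReal.ofReal E) :
    ‖cgrad f z₀‖ ≤ exp (2 * π * E * (64 * C) ^ 2 + 1) / (4 * C * η) := by
  set Q := 2 * π * E * (64 * C) ^ 2 + 1 with hQ
  have hpi := pi_pos
  have hQ1 : 1 ≤ Q := by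
    have : 0 ≤ 2 * π * E * (64 * C) ^ 2 := by positivity
    linarith
  have hsub : closedBall z₀ η ⊆ ball 0 1 := fun z hz' => by
    rw [mem_closedBall, dist_eq_norm] at hz'
    rw [mem_ball_zero_iff]
    have := norm_add_le (z - z₀) z₀
    rw [sub_add_cancel] at this
    linarith
  set δ := η * exp (-Q) with hδ
  have hδ0 : 0 < δ := by positivity
  have hδη : δ < η := by
    have : exp (-Q) < 1 := by rw [exp_lt_one_iff]; linarith
    rw [hδ]; nlinarith
  have hlog : log (η / δ) = Q := by
    have : η / δ = exp Q := by rw [hδ, exp_neg]; field_simp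
    rw [this, log_exp]
  have hosc : ∀ z ∈ closedBall z₀ δ, |f z - f z₀| ≤ 1 / (64 * C) := fun z hz => by
    have h1 := sq_sub_mul_log_le isOpen_ball hf hδ0 hδη hE hsub hcrit
      ((MeasureTheory.lintegral_mono_set (ball_subset_closedBall.trans hsub)).trans hfi) hz
    rw [hlog] at h1
    refine abs_le_of_sq_le_sq ?_ (by positivity)
    rw [div_pow, one_pow, le_div_iff₀ (by positivity)]
    by_contra! hcon
    have h2 : Q ≤ (f z - f z₀) ^ 2 * (64 * C) ^ 2 * Q := by nlinarith
    have h3 : (f z - f z₀) ^ 2 * (64 * C) ^ 2 * Q ≤ 2 * π * E * (64 * C) ^ 2 := by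
      calc _ = ((f z - f z₀) ^ 2 * Q) * (64 * C) ^ 2 := by ring
        _ ≤ _ := by gcongr
    linarith
  have hδsub : closedBall z₀ δ ⊆ ball 0 1 := (closedBall_subset_closedBall hδη.le).trans hsub
  have h := norm_cgrad_le_of_small_oscillation isOpen_ball hf hδ0 hδsub hC (M := 1 / (64 * C))
    (c := f z₀) (by field_simp; norm_num) (fun z hz => hlap z (hδsub hz)) hosc
  have hexp : exp Q = η / δ := by rw [hδ, exp_neg]; field_simp
  rw [hexp, div_div, le_div_iff₀ (by positivity)]
  calc _ = 4 * (C * (δ * ‖cgrad f z₀‖)) * η := by ring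
    _ ≤ 4 * (1 / 4) * η := by gcongr
    _ = η := by ring

namespace IsConformalPMC

variable {Y : ℂ → F} {W : ℂ → ℝ} {H : F → F}

lemma differentiableAt (hY : IsConformalPMC Y W H) {z : ℂ} (hz : z ∈ ball (0 : ℂ) 1) :
    DifferentiableAt ℝ Y z :=
  (hY.contDiffOn.differentiableOn two_ne_zero).differentiableAt (isOpen_ball.mem_nhds hz)

lemma norm_fderiv_sq (hY : IsConformalPMC Y W H) {z : ℂ} (hz : z ∈ ball (0 : ℂ) 1) (v : ℂ) :
    ‖fderiv ℝ Y z v‖ ^ 2 = W z * ‖v‖ ^ 2 := by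
  have e : fderiv ℝ Y z v = v.re • fderiv ℝ Y z 1 + v.im • fderiv ℝ Y z Complex.I := by
    rw [← map_smul, ← map_smul, ← map_add]
    congr 1
    simp [Complex.re_add_im]
  rw [e, norm_add_sq_real, inner_smul_left, inner_smul_right, hY.inner_eq_zero z hz, norm_smul,
    norm_smul, mul_pow, mul_pow, hY.norm_one z hz, hY.norm_I z hz, ← Complex.normSq_eq_norm_sq,
    Complex.normSq_apply]
  simp
  ring

lemma continuousOn_area (hY : IsConformalPMC Y W H) : ContinuousOn W (ball 0 1) :=
  (((contDiffOn_fderiv_apply isOpen_ball hY.contDiffOn 1).continuousOn.norm.pow 2)).congr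
    fun z hz => (hY.norm_one z hz).symm

lemma norm_cgrad_sq_le (hY : IsConformalPMC Y W H) {z : ℂ} (hz : z ∈ ball (0 : ℂ) 1) (e : F) :
    ‖cgrad (fun w => ⟪e, Y w⟫) z‖ ^ 2 ≤ 2 * W z * ‖e‖ ^ 2 := by
  have key : ∀ p : F, ⟪e, p⟫ ^ 2 ≤ ‖p‖ ^ 2 * ‖e‖ ^ 2 := fun p => by
    rw [← mul_pow, ← sq_abs, mul_comm ‖p‖]
    gcongr
    exact abs_real_inner_le_norm e p
  rw [norm_cgrad_inner_const_sq (hY.differentiableAt hz)]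
  have h1 := key (fderiv ℝ Y z 1)
  have h2 := key (fderiv ℝ Y z Complex.I)
  rw [hY.norm_one z hz] at h1
  rw [hY.norm_I z hz] at h2
  linarith

lemma abs_lap_le (hY : IsConformalPMC Y W H) {A : ℝ} (hH : ∀ y, ‖H y‖ ≤ A) {z : ℂ}
    (hz : z ∈ ball (0 : ℂ) 1) (e : F) :
    |lap (fun w => ⟪e, Y w⟫) z| ≤ 6 * A * W z * ‖e‖ := by
  rw [lap_inner_const isOpen_ball hY.contDiffOn hz, hY.laplacian z hz, inner_smul_right, abs_mul,
    abs_two]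
  have h1 := abs_real_inner_le_norm e (scaledNormal (W z) (H (Y z)) (fderiv ℝ Y z 1)
    (fderiv ℝ Y z Complex.I))
  have h2 := norm_scaledNormal_le (hH (Y z)) (hY.norm_one z hz) (hY.norm_I z hz)
  have h3 := mul_le_mul_of_nonneg_left h2 (norm_nonneg e)
  linarith

end IsConformalPMC

/-- Two-sided bounds for the area element of a geodesic disc of bounded energy whose normals
stay away from the direction `e`. -/
lemma exists_area_element_bounds (F : Type*) [NormedAddCommGroup F] [InnerProductSpace ℝ F]
    {s A E : ℝ} (hs : 0 < s) (hA : 0 ≤ A) (hE : 0 ≤ E) :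
    ∃ κ L : ℝ, 0 < κ ∧ 0 < L ∧ ∀ (Y : ℂ → F) (W : ℂ → ℝ) (H : F → F) (e : F),
      IsConformalPMC Y W H → (∀ y, ‖H y‖ ≤ A) → ‖e‖ = 1 →
      (∀ z ∈ ball (0 : ℂ) 1, s ^ 2 * W z ≤ ‖cgrad (fun w => ⟪e, Y w⟫) z‖ ^ 2) →
      (∫⁻ z in ball (0 : ℂ) 1, ENNReal.ofReal (W z) ≤ ENNReal.ofReal E) →
      (∀ e : ℂ, ‖e‖ = 1 → 1 ≤ ∫ t in (0 : ℝ)..1, ‖deriv (fun t : ℝ => Y (t • e)) t‖) →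
      κ ≤ W 0 ∧ ∀ z ∈ closedBall (0 : ℂ) (1 / 2), W z ≤ L ^ 2 := by
  set C := 6 * A / s ^ 2 + 1 with hCdef
  have hC : 0 < C := by positivity
  set ε := 1 / (2 * (E + 1)) with hεdef
  have hε0 : 0 < ε := by positivity
  have hε : ε ≤ 1 / 2 := by
    rw [hεdef, div_le_div_iff₀ (by positivity) (by norm_num)]; linarith
  set L₀ := exp (2 * π * (2 * E) * (64 * C) ^ 2 + 1) / (4 * C * (ε / 4)) with hL₀
  have hL₀0 : 0 < L₀ := by positivity
  obtain ⟨n, hn⟩ := exists_nat_ge (2 / (ε / 2))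
  set g := L₀ * exp (-(4 ^ n * (log (L₀ / (s / 2)) + 2 * (C * L₀) * (ε / 2)))) with hg
  have hg0 : 0 < g := by positivity
  refine ⟨g ^ 2 / 2, L₀ / s, by positivity, by positivity, ?_⟩
  intro Y W H e hY hH he hgrad hEn hlen
  set f := fun w => ⟪e, Y w⟫ with hf
  have hfc : ContDiffOn ℝ 2 f (ball 0 1) := contDiffOn_inner_const hY.contDiffOn e
  have hcrit : ∀ z ∈ ball (0 : ℂ) 1, cgrad f z ≠ 0 := fun z hz h0 => by
    have h1 := hgrad z hz
    have h2 := hY.pos z hz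
    rw [h0, norm_zero] at h1
    have : 0 < s ^ 2 * W z := by positivity
    linarith
  have hlap : ∀ z ∈ ball (0 : ℂ) 1, |lap f z| ≤ C * ‖cgrad f z‖ ^ 2 := fun z hz => by
    have h1 := hY.abs_lap_le hH hz e
    have h2 := hgrad z hz
    rw [he, mul_one] at h1
    have h3 : 6 * A * W z = 6 * A / s ^ 2 * (s ^ 2 * W z) := by field_simp
    have h4 : 6 * A / s ^ 2 * (s ^ 2 * W z) ≤ 6 * A / s ^ 2 * ‖cgrad f z‖ ^ 2 := by gcongr
    rw [hCdef]
    linarith [sq_nonneg ‖cgrad f z‖]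
  have hfi : ∫⁻ z in ball (0 : ℂ) 1, ENNReal.ofReal (‖cgrad f z‖ ^ 2) ≤
      ENNReal.ofReal (2 * E) := by
    rw [ENNReal.ofReal_mul zero_le_two]
    refine le_trans ?_ (mul_le_mul_right hEn _)
    rw [← MeasureTheory.lintegral_const_mul' _ _ ENNReal.ofReal_ne_top]
    refine MeasureTheory.setLIntegral_mono' measurableSet_ball fun z hz => ?_
    rw [← ENNReal.ofReal_mul zero_le_two]
    refine ENNReal.ofReal_le_ofReal ?_
    have := hY.norm_cgrad_sq_le hz e
    rwa [he, one_pow, mul_one] at this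
  have hbound : ∀ z ∈ closedBall (0 : ℂ) (1 - ε / 2), ‖cgrad f z‖ ≤ L₀ := fun z hz => by
    rw [mem_closedBall_zero_iff] at hz
    exact norm_cgrad_le_of_energy hC (by positivity) (by positivity) (by linarith) hfc hcrit hlap
      hfi
  have hsub : closedBall (0 : ℂ) (1 - ε / 2) ⊆ ball 0 1 := closedBall_subset_ball (by linarith)
  constructor
  · obtain ⟨w₁, hw₁, hWw⟩ := exists_area_element_ge hE
      (hY.contDiffOn.differentiableOn two_ne_zero) hY.continuousOn_area
      (fun z hz v => hY.norm_fderiv_sq hz v) hEn hlen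
    have hw₁b : w₁ ∈ ball (0 : ℂ) 1 := by rw [mem_ball_zero_iff]; linarith
    have hm : s / 2 ≤ ‖cgrad f w₁‖ := by
      have h1 := hgrad w₁ hw₁b
      refine (sq_le_sq₀ (by positivity) (norm_nonneg _)).mp ?_
      nlinarith [sq_nonneg s]
    have h0b : (0 : ℂ) ∈ ball (0 : ℂ) 1 := mem_ball_self one_pos
    have hfin := norm_lower_bound (h := cgrad f) (T' := 1) (T := 1 - ε / 2) (R := ε / 2)
      (S := C * L₀) (L := L₀) (m := s / 2) (w₁ := w₁) (n := n) (by linarith)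
      (contDiffOn_cgrad isOpen_ball hfc) hcrit (by positivity) (by positivity)
      (fun z hz => by
        rw [dbar_cgrad isOpen_ball hfc (hsub hz), Complex.norm_real, Real.norm_eq_abs]
        refine (hlap z (hsub hz)).trans ?_
        rw [mul_assoc, sq]
        gcongr
        exact hbound z hz)
      hbound (by linarith)
      (by
        have := (div_le_iff₀ (by positivity)).mp hn
        nlinarith)
      (by positivity) hm
    have h1 := hY.norm_cgrad_sq_le h0b e
    rw [he, one_pow, mul_one] at h1
    have h2 : g ^ 2 ≤ ‖cgrad f 0‖ ^ 2 := by gcongr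
    linarith
  · intro z hz
    have hz' := closedBall_subset_closedBall (show (1 / 2 : ℝ) ≤ 1 - ε / 2 by linarith) hz
    have h1 := hgrad z (hsub hz')
    have h2 := hbound z hz'
    rw [div_pow, le_div_iff₀ (by positivity), mul_comm]
    exact h1.trans (by gcongr)

namespace IsConformalPMC

variable {Y : ℂ → F} {W : ℂ → ℝ} {H : F → F} {A L : ℝ}

lemma norm_sub_le (hY : IsConformalPMC Y W H) (hL : 0 ≤ L)
    (hW : ∀ z ∈ closedBall (0 : ℂ) (1 / 2), W z ≤ L ^ 2) {z w : ℂ}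
    (hz : z ∈ closedBall (0 : ℂ) (1 / 2)) (hw : w ∈ closedBall (0 : ℂ) (1 / 2)) :
    ‖Y z - Y w‖ ≤ L * ‖z - w‖ := by
  have hsub : closedBall (0 : ℂ) (1 / 2) ⊆ ball 0 1 := closedBall_subset_ball (by norm_num)
  refine (convex_closedBall (0 : ℂ) (1 / 2)).norm_image_sub_le_of_norm_fderiv_le (𝕜 := ℝ)
    (fun x hx => hY.differentiableAt (hsub hx)) (fun x hx => ?_) hw hz
  refine ContinuousLinearMap.opNorm_le_bound _ hL fun v => ?_
  refine (sq_le_sq₀ (norm_nonneg _) (by positivity)).mp ?_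
  rw [hY.norm_fderiv_sq (hsub hx), mul_pow]
  gcongr
  exact hW x hx

lemma norm_fderiv_sub_le (hY : IsConformalPMC Y W H) (hA : 0 ≤ A) (hH : ∀ y, ‖H y‖ ≤ A)
    (hL : 0 ≤ L) (hW : ∀ z ∈ closedBall (0 : ℂ) (1 / 2), W z ≤ L ^ 2) {z : ℂ}
    (hz : ‖z‖ ≤ 1 / 16) :
    ‖fderiv ℝ Y z 1 - fderiv ℝ Y 0 1‖ ≤ (2 * L + 12 * A * L ^ 2) * √‖z‖ ∧
      ‖fderiv ℝ Y z Complex.I - fderiv ℝ Y 0 Complex.I‖ ≤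
        (2 * L + 12 * A * L ^ 2) * √‖z‖ := by
  rcases eq_or_ne z 0 with rfl | hz0
  · simp
  have hzpos : 0 < ‖z‖ := norm_pos_iff.mpr hz0
  set ρ := √‖z‖ with hρ
  have hρ0 : 0 < ρ := Real.sqrt_pos.mpr hzpos
  have hρ2 : ρ ^ 2 = ‖z‖ := Real.sq_sqrt hzpos.le
  have hρ4 : ρ ≤ 1 / 4 := by
    rw [hρ, Real.sqrt_le_left (by norm_num)]; norm_num; linarith
  have hsub : closedBall (0 : ℂ) (1 / 2) ⊆ ball 0 1 := closedBall_subset_ball (by norm_num)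
  have hmem : ∀ w ∈ ball (0 : ℂ) (7 / 16), w + z ∈ closedBall (0 : ℂ) (1 / 2) := fun w hw => by
    rw [mem_ball_zero_iff] at hw
    rw [mem_closedBall_zero_iff]
    exact (norm_add_le _ _).trans (by linarith)
  have hmem' : ball (0 : ℂ) (7 / 16) ⊆ closedBall (0 : ℂ) (1 / 2) := fun w hw => by
    rw [mem_ball_zero_iff] at hw
    rw [mem_closedBall_zero_iff]
    linarith
  have h0 : (0 : ℂ) ∈ ball (0 : ℂ) (7 / 16) := mem_ball_self (by norm_num)
  have key : ∀ e : F, ‖cgrad (fun w => ⟪e, Y w⟫) z - cgrad (fun w => ⟪e, Y w⟫) 0‖ ≤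
      ‖e‖ * ((2 * L + 12 * A * L ^ 2) * ρ) := by
    intro e
    set f := fun w => ⟪e, Y w⟫ with hf
    have hfc : ContDiffOn ℝ 2 f (ball 0 1) := contDiffOn_inner_const hY.contDiffOn e
    set v := fun w => f (w + z) - f w with hv
    have hshift : ContDiffOn ℝ 2 (fun w => f (w + z)) (ball (0 : ℂ) (7 / 16)) :=
      hfc.comp (contDiff_id.add contDiff_const).contDiffOn fun w hw => hsub (hmem w hw)
    have hfc' := hfc.mono (hmem'.trans hsub)
    have hvc : ContDiffOn ℝ 2 v (ball (0 : ℂ) (7 / 16)) := hshift.sub hfc'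
    have hd1 : ∀ w ∈ ball (0 : ℂ) (7 / 16), ∀ x,
        fderiv ℝ v w x = fderiv ℝ f (w + z) x - fderiv ℝ f w x := fun w hw x => by
      rw [hv, fderiv_fun_sub ((hshift.differentiableOn two_ne_zero).differentiableAt
        (isOpen_ball.mem_nhds hw)) ((hfc'.differentiableOn two_ne_zero).differentiableAt
        (isOpen_ball.mem_nhds hw)), fderiv_comp_add_right]
      rfl
    have hcg : cgrad v 0 = cgrad f z - cgrad f 0 := by
      simp only [cgrad, hd1 0 h0, zero_add]; push_cast; ring
    have hd2 : ∀ w ∈ ball (0 : ℂ) (7 / 16), ∀ x y, fderiv ℝ (fun u => fderiv ℝ v u x) w y =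
        fderiv ℝ (fun u => fderiv ℝ f u x) (w + z) y - fderiv ℝ (fun u => fderiv ℝ f u x) w y := by
      intro w hw x y
      have h1 : (fun u => fderiv ℝ v u x) =ᶠ[nhds w]
          fun u => fderiv ℝ f (u + z) x - fderiv ℝ f u x := by
        filter_upwards [isOpen_ball.mem_nhds hw] with u hu using hd1 u hu x
      have h2 := (contDiffOn_fderiv_apply isOpen_ball hfc x).differentiableOn one_ne_zero
      have h3 : DifferentiableAt ℝ (fun u => fderiv ℝ f u x) (w + z) :=
        h2.differentiableAt (isOpen_ball.mem_nhds (hsub (hmem w hw)))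
      have h4 : DifferentiableAt ℝ (fun u => fderiv ℝ f u x) w :=
        h2.differentiableAt (isOpen_ball.mem_nhds (hsub (hmem' hw)))
      have h5 : DifferentiableAt ℝ (fun u => fderiv ℝ f (u + z) x) w :=
        DifferentiableAt.comp w (g := fun u => fderiv ℝ f u x) h3 (by fun_prop)
      rw [h1.fderiv_eq, fderiv_fun_sub h5 h4]
      have h6 := fderiv_comp_add_right (𝕜 := ℝ) (f := fun u => fderiv ℝ f u x) (x := w) z
      rw [h6]
      rfl
    have hlapv : ∀ w ∈ ball (0 : ℂ) (7 / 16), lap v w = lap f (w + z) - lap f w := fun w hw => by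
      simp only [lap, hd2 w hw]; ring
    have hR : closedBall (0 : ℂ) ρ ⊆ ball (0 : ℂ) (7 / 16) :=
      closedBall_subset_ball (by linarith)
    have := norm_cgrad_le isOpen_ball hvc hρ0 hR (M := ‖e‖ * (L * ‖z‖))
      (S := 12 * A * L ^ 2 * ‖e‖)
      (fun w hw => by
        have h1 : v w = ⟪e, Y (w + z) - Y w⟫ := by rw [hv, hf, inner_sub_right]
        rw [h1]
        refine (abs_real_inner_le_norm _ _).trans ?_
        gcongr
        have := hY.norm_sub_le hL hW (hmem w (hR hw)) (hmem' (hR hw))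
        rwa [add_sub_cancel_left] at this)
      (fun w hw => by
        have h1 := hY.abs_lap_le hH (hsub (hmem w (hR hw))) e
        have h2 := hY.abs_lap_le hH (hsub (hmem' (hR hw))) e
        have h3 : 6 * A * W (w + z) * ‖e‖ ≤ 6 * A * L ^ 2 * ‖e‖ := by
          gcongr; exact hW _ (hmem w (hR hw))
        have h4 : 6 * A * W w * ‖e‖ ≤ 6 * A * L ^ 2 * ‖e‖ := by
          gcongr; exact hW _ (hmem' (hR hw))
        rw [hlapv w (hR hw)]
        linarith [abs_sub (lap f (w + z)) (lap f w)])
    rw [hcg] at this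
    refine this.trans (le_of_eq ?_)
    rw [← hρ2]
    field_simp
  have hz1 : z ∈ ball (0 : ℂ) 1 := by rw [mem_ball_zero_iff]; linarith
  have h01 : (0 : ℂ) ∈ ball (0 : ℂ) 1 := mem_ball_self one_pos
  have hsq : ∀ e : F, ‖cgrad (fun w => ⟪e, Y w⟫) z - cgrad (fun w => ⟪e, Y w⟫) 0‖ ^ 2 =
      ⟪e, fderiv ℝ Y z 1 - fderiv ℝ Y 0 1⟫ ^ 2 +
        ⟪e, fderiv ℝ Y z Complex.I - fderiv ℝ Y 0 Complex.I⟫ ^ 2 := fun e => by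
    rw [← Complex.normSq_eq_norm_sq, Complex.normSq_apply]
    simp only [cgrad, fderiv_inner_const (hY.differentiableAt hz1),
      fderiv_inner_const (hY.differentiableAt h01), inner_sub_right]
    simp
    ring
  have hD : 0 ≤ (2 * L + 12 * A * L ^ 2) * ρ := by positivity
  have fin : ∀ e : F, ‖e‖ ^ 2 * ‖e‖ ^ 2 ≤
      ‖cgrad (fun w => ⟪e, Y w⟫) z - cgrad (fun w => ⟪e, Y w⟫) 0‖ ^ 2 →
      ‖e‖ ≤ (2 * L + 12 * A * L ^ 2) * ρ := fun e he => by
    by_contra! hcon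
    have h1 : 0 < ‖e‖ := hD.trans_lt hcon
    have h2 : ‖e‖ ^ 2 * ‖e‖ ^ 2 ≤ (‖e‖ * ((2 * L + 12 * A * L ^ 2) * ρ)) ^ 2 :=
      he.trans (by gcongr; exact key e)
    rw [← mul_pow] at h2
    have h3 := (sq_le_sq₀ (by positivity) (by positivity)).mp h2
    have h4 := le_of_mul_le_mul_left h3 h1
    linarith
  constructor
  · refine fin _ ?_
    rw [hsq, real_inner_self_eq_norm_sq]
    nlinarith [sq_nonneg ⟪fderiv ℝ Y z 1 - fderiv ℝ Y 0 1,
      fderiv ℝ Y z Complex.I - fderiv ℝ Y 0 Complex.I⟫]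
  · refine fin _ ?_
    rw [hsq, real_inner_self_eq_norm_sq]
    nlinarith [sq_nonneg ⟪fderiv ℝ Y z Complex.I - fderiv ℝ Y 0 Complex.I,
      fderiv ℝ Y z 1 - fderiv ℝ Y 0 1⟫]

/-- Interior bound for the second derivatives at the center. -/
lemma second_derivative_le (hY : IsConformalPMC Y W H) {b α : ℝ} (hA : 0 ≤ A)
    (hH : ∀ y, ‖H y‖ ≤ A) (hb : 0 ≤ b) (hα : 0 < α) (hα1 : α < 1)
    (hHα : ∀ x y, ‖H x - H y‖ ≤ b * ‖x - y‖ ^ α) (hL : 0 < L)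
    (hW : ∀ z ∈ closedBall (0 : ℂ) (1 / 2), W z ≤ L ^ 2) {K : ℝ}
    (hK : K = 2 * (2 * L + 6 * A * L ^ 2) / (1 / 16) + 2 * (6 * (b * L ^ α * L ^ 2 +
      2 * A * L * (2 * L + 12 * A * L ^ 2))) * (1 / 16) ^ (α / 2) / (α / 2)) :
    ‖fderiv ℝ (fun w => fderiv ℝ Y w 1) 0 1 -
        fderiv ℝ (fun w => fderiv ℝ Y w Complex.I) 0 Complex.I‖ ≤ K ∧
      ‖fderiv ℝ (fun w => fderiv ℝ Y w 1) 0 Complex.I‖ ≤ K := by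
  set D := 2 * L + 12 * A * L ^ 2 with hD
  set Γ := 6 * (b * L ^ α * L ^ 2 + 2 * A * L * D) with hΓ
  have hD0 : 0 ≤ D := by positivity
  have hK0 : 0 ≤ K := by rw [hK]; positivity
  have h01 : (0 : ℂ) ∈ ball (0 : ℂ) 1 := mem_ball_self one_pos
  have h0h : (0 : ℂ) ∈ closedBall (0 : ℂ) (1 / 2) := mem_closedBall_self (by norm_num)
  have hsub : closedBall (0 : ℂ) (1 / 2) ⊆ ball 0 1 := closedBall_subset_ball (by norm_num)
  have hsub' : closedBall (0 : ℂ) (1 / 16) ⊆ closedBall 0 (1 / 2) :=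
    closedBall_subset_closedBall (by norm_num)
  have hp : ∀ z ∈ closedBall (0 : ℂ) (1 / 2), ‖fderiv ℝ Y z 1‖ ≤ L := fun z hz =>
    (sq_le_sq₀ (norm_nonneg _) hL.le).mp (by rw [hY.norm_one z (hsub hz)]; exact hW z hz)
  have hq : ∀ z ∈ closedBall (0 : ℂ) (1 / 2), ‖fderiv ℝ Y z Complex.I‖ ≤ L := fun z hz =>
    (sq_le_sq₀ (norm_nonneg _) hL.le).mp (by rw [hY.norm_I z (hsub hz)]; exact hW z hz)
  have key : ∀ e : F,
      |⟪e, fderiv ℝ (fun w => fderiv ℝ Y w 1) 0 1 -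
        fderiv ℝ (fun w => fderiv ℝ Y w Complex.I) 0 Complex.I⟫| ≤ ‖e‖ * K ∧
      2 * |⟪e, fderiv ℝ (fun w => fderiv ℝ Y w 1) 0 Complex.I⟫| ≤ ‖e‖ * K := by
    intro e
    have := _root_.second_derivative_le isOpen_ball (contDiffOn_inner_const hY.contDiffOn e)
      (z₀ := 0) (R := 1 / 16) (L := 2 * L * ‖e‖) (S := 6 * A * L ^ 2 * ‖e‖) (Γ := Γ * ‖e‖)
      (β := α / 2) (by norm_num) (by norm_num) (by positivity) (hsub'.trans hsub)
      (fun z hz => by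
        refine (sq_le_sq₀ (norm_nonneg _) (by positivity)).mp ?_
        refine (hY.norm_cgrad_sq_le (hsub (hsub' hz)) e).trans ?_
        rw [mul_pow, mul_pow]
        gcongr ?_ * _
        linarith [hW z (hsub' hz), sq_nonneg L])
      (by
        refine (hY.abs_lap_le hH h01 e).trans ?_
        gcongr
        exact hW 0 h0h)
      (fun z hz => by
        have hzn : ‖z‖ ≤ 1 / 16 := mem_closedBall_zero_iff.mp hz
        have hz1 : ‖z‖ ≤ 1 := by linarith
        obtain ⟨hd1, hd2⟩ := hY.norm_fderiv_sub_le hA hH hL.le hW hzn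
        have hpow : ∀ γ : ℝ, α / 2 ≤ γ → ‖z‖ ^ γ ≤ ‖z‖ ^ (α / 2) := fun γ hγ =>
          Real.rpow_le_rpow_of_exponent_ge' (norm_nonneg _) hz1 (by positivity) hγ
        have hs : √‖z‖ ≤ ‖z‖ ^ (α / 2) := by
          rw [Real.sqrt_eq_rpow]; exact hpow _ (by linarith)
        have hHd : ‖H (Y z) - H (Y 0)‖ ≤ b * L ^ α * ‖z‖ ^ (α / 2) := by
          have h1 := hY.norm_sub_le hL.le hW (hsub' hz) h0h
          rw [sub_zero] at h1
          calc _ ≤ b * ‖Y z - Y 0‖ ^ α := hHα _ _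
            _ ≤ b * (L * ‖z‖) ^ α := by gcongr
            _ = b * L ^ α * ‖z‖ ^ α := by rw [Real.mul_rpow hL.le (norm_nonneg _)]; ring
            _ ≤ _ := by gcongr b * L ^ α * ?_; exact hpow _ (by linarith)
        have hdiff := norm_scaledNormal_sub_le (hH (Y 0)) (hY.norm_one z (hsub (hsub' hz)))
          (hY.norm_one 0 h01) (hp z (hsub' hz)) (hp 0 h0h) (hq z (hsub' hz)) (hq 0 h0h) hHd
          (hd1.trans (mul_le_mul_of_nonneg_left hs hD0))
          (hd2.trans (mul_le_mul_of_nonneg_left hs hD0))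
        rw [lap_inner_const isOpen_ball hY.contDiffOn (hsub (hsub' hz)),
          lap_inner_const isOpen_ball hY.contDiffOn h01, hY.laplacian z (hsub (hsub' hz)),
          hY.laplacian 0 h01, ← inner_sub_right, ← smul_sub, inner_smul_right, abs_mul, abs_two,
          sub_zero]
        have h2 := (abs_real_inner_le_norm e _).trans
          (mul_le_mul_of_nonneg_left hdiff (norm_nonneg e))
        refine (mul_le_mul_of_nonneg_left h2 zero_le_two).trans (le_of_eq ?_)
        rw [hΓ]; ring)
    rw [fderiv_fderiv_inner_const isOpen_ball hY.contDiffOn h01,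
      fderiv_fderiv_inner_const isOpen_ball hY.contDiffOn h01,
      fderiv_fderiv_inner_const isOpen_ball hY.contDiffOn h01, ← inner_sub_right] at this
    have hKe : 2 * (2 * L * ‖e‖ + 6 * A * L ^ 2 * ‖e‖) / (1 / 16) +
        2 * (Γ * ‖e‖) * (1 / 16) ^ (α / 2) / (α / 2) = ‖e‖ * K := by rw [hK]; ring
    rwa [hKe] at this
  have fin : ∀ e : F, |⟪e, e⟫| ≤ ‖e‖ * K → ‖e‖ ≤ K := fun e he => by
    rw [real_inner_self_eq_norm_sq, abs_of_nonneg (sq_nonneg _), sq] at he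
    by_contra! hcon
    have := le_of_mul_le_mul_left he (hK0.trans_lt hcon)
    linarith
  refine ⟨fin _ (key _).1, fin _ ?_⟩
  have := (key (fderiv ℝ (fun w => fderiv ℝ Y w 1) 0 Complex.I)).2
  have h2 := abs_nonneg ⟪fderiv ℝ (fun w => fderiv ℝ Y w 1) 0 Complex.I,
    fderiv ℝ (fun w => fderiv ℝ Y w 1) 0 Complex.I⟫
  linarith

end IsConformalPMC

end PrescribedMeanCurvature

lemma norm_le_of_forall_abs_inner_le {F : Type*} [NormedAddCommGroup F] [InnerProductSpace ℝ F]
    {v : F} {c : ℝ} (hc : 0 ≤ c) (h : ∀ z : F, ‖z‖ = 1 → |⟪v, z⟫| ≤ c) : ‖v‖ ≤ c := by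
  rcases eq_or_ne v 0 with rfl | hv
  · simpa using hc
  have hv' : ‖v‖ ≠ 0 := norm_ne_zero_iff.mpr hv
  have h1 := h (‖v‖⁻¹ • v) (by rw [norm_smul, norm_inv, norm_norm, inv_mul_cancel₀ hv'])
  rw [inner_smul_right, real_inner_self_eq_norm_sq] at h1
  have h2 : ‖v‖⁻¹ * ‖v‖ ^ 2 = ‖v‖ := by field_simp
  rw [h2] at h1
  exact (le_abs_self _).trans h1

lemma normal_part_eq_scaledNormal {W : ℝ} {h p q n₁ n₂ : E4} (hW : 0 < W) (hp : ‖p‖ ^ 2 = W)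
    (hq : ‖q‖ ^ 2 = W) (hpq : ⟪p, q⟫ = 0) (hn₁ : ‖n₁‖ = 1) (hn₂ : ‖n₂‖ = 1) (hnn : ⟪n₁, n₂⟫ = 0)
    (h1p : ⟪n₁, p⟫ = 0) (h1q : ⟪n₁, q⟫ = 0) (h2p : ⟪n₂, p⟫ = 0) (h2q : ⟪n₂, q⟫ = 0) :
    (⟪h, n₁⟫ * W) • n₁ + (⟪h, n₂⟫ * W) • n₂ = scaledNormal W h p q := by
  have hsW : √W ≠ 0 := (Real.sqrt_pos.mpr hW).ne'
  have hs2 : √W * √W = W := Real.mul_self_sqrt hW.le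
  have hp' : ‖p‖ = √W := by rw [← hp, Real.sqrt_sq (norm_nonneg _)]
  have hq' : ‖q‖ = √W := by rw [← hq, Real.sqrt_sq (norm_nonneg _)]
  have hv : Orthonormal ℝ ![(√W)⁻¹ • p, (√W)⁻¹ • q, n₁, n₂] := by
    constructor
    · intro i
      fin_cases i
      · simp [norm_smul, hp', abs_of_nonneg (Real.sqrt_nonneg W), hsW]
      · simp [norm_smul, hq', abs_of_nonneg (Real.sqrt_nonneg W), hsW]
      · simpa using hn₁
      · simpa using hn₂
    · intro i j hij
      fin_cases i <;> fin_cases j <;>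
        first
        | exact absurd rfl hij
        | simp [inner_smul_left, inner_smul_right, hpq, real_inner_comm p q, hnn, h1p, h1q, h2p,
            h2q, real_inner_comm n₁ p, real_inner_comm n₁ q, real_inner_comm n₂ p,
            real_inner_comm n₂ q, real_inner_comm n₁ n₂]
  have hcard : Fintype.card (Fin 4) = Module.finrank ℝ E4 := by simp
  have hb := (basisOfOrthonormalOfCardEqFinrank hv hcard).toOrthonormalBasis (by
    rw [coe_basisOfOrthonormalOfCardEqFinrank]; exact hv) |>.sum_repr' h
  simp only [Module.Basis.coe_toOrthonormalBasis, coe_basisOfOrthonormalOfCardEqFinrank,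
    Fin.sum_univ_four] at hb
  simp [inner_smul_left, smul_smul] at hb
  have e : ∀ y : ℝ, (√W)⁻¹ * y * (√W)⁻¹ * W = y := fun y => by
    calc (√W)⁻¹ * y * (√W)⁻¹ * W = (√W)⁻¹ * y * (√W)⁻¹ * (√W * √W) := by rw [hs2]
      _ = y := by field_simp
  have h3 : W • h = ⟪p, h⟫ • p + ⟪q, h⟫ • q + (⟪n₁, h⟫ * W) • n₁ + (⟪n₂, h⟫ * W) • n₂ := by
    conv_lhs => rw [← hb]
    simp only [smul_add, smul_smul]
    congr 1
    · congr 1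
      · congr 1
        · rw [mul_comm, e]
        · rw [mul_comm, e]
      · rw [mul_comm]
    · rw [mul_comm]
  rw [scaledNormal, h3, real_inner_comm n₁ h, real_inner_comm n₂ h, real_inner_comm p h,
    real_inner_comm q h]
  abel

lemma sq_sin_mul_le {F : Type*} [NormedAddCommGroup F] [InnerProductSpace ℝ F] {W ω : ℝ}
    {e p q : F} (hW : 0 < W) (hp : ‖p‖ ^ 2 = W) (hq : ‖q‖ ^ 2 = W) (hpq : ⟪p, q⟫ = 0)
    (he : ‖e‖ = 1)
    (h : ∀ n : F, ‖n‖ = 1 → ⟪n, p⟫ = 0 → ⟪n, q⟫ = 0 → |⟪n, e⟫| ≤ cos ω) :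
    sin ω ^ 2 * W ≤ ⟪e, p⟫ ^ 2 + ⟪e, q⟫ ^ 2 := by
  set n := e - (⟪e, p⟫ / W) • p - (⟪e, q⟫ / W) • q with hn
  have hpp : ⟪p, p⟫ = W := by rw [real_inner_self_eq_norm_sq, hp]
  have hqq : ⟪q, q⟫ = W := by rw [real_inner_self_eq_norm_sq, hq]
  have hqp : ⟪q, p⟫ = 0 := by rw [real_inner_comm, hpq]
  have hnp : ⟪n, p⟫ = 0 := by
    rw [hn]
    simp only [inner_sub_left, inner_smul_left, hpp, hqp]
    simp; field_simp; ring
  have hnq : ⟪n, q⟫ = 0 := by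
    rw [hn]
    simp only [inner_sub_left, inner_smul_left, hqq, hpq]
    simp; field_simp; ring
  have hne : ⟪n, e⟫ = 1 - (⟪e, p⟫ ^ 2 + ⟪e, q⟫ ^ 2) / W := by
    rw [hn]
    simp only [inner_sub_left, inner_smul_left, real_inner_self_eq_norm_sq, he,
      real_inner_comm e p, real_inner_comm e q]
    simp; ring
  have hnn : ‖n‖ ^ 2 = ⟪n, e⟫ := by
    rw [← real_inner_self_eq_norm_sq]
    conv_lhs => rw [hn, inner_sub_right, inner_sub_right, inner_smul_right, inner_smul_right, ← hn,
      hnp, hnq]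
    ring
  have hle : ‖n‖ ^ 2 ≤ cos ω ^ 2 := by
    rcases eq_or_ne n 0 with h0 | h0
    · rw [h0, norm_zero]; simpa using sq_nonneg (cos ω)
    have hn0 : ‖n‖ ≠ 0 := norm_ne_zero_iff.mpr h0
    have h1 := h (‖n‖⁻¹ • n) (by rw [norm_smul, norm_inv, norm_norm, inv_mul_cancel₀ hn0])
      (by rw [inner_smul_left, hnp, mul_zero]) (by rw [inner_smul_left, hnq, mul_zero])
    rw [inner_smul_left, ← hnn] at h1
    have h2 : ‖n‖⁻¹ * ‖n‖ ^ 2 = ‖n‖ := by field_simp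
    simp only [conj_trivial] at h1
    rw [h2, abs_norm] at h1
    gcongr
  rw [hnn, hne] at hle
  have h3 : sin ω ^ 2 ≤ (⟪e, p⟫ ^ 2 + ⟪e, q⟫ ^ 2) / W := by linarith [sin_sq_add_cos_sq ω]
  rwa [le_div_iff₀ hW] at h3

/-- The area element of a conformally parametrized graph is controlled by the Jacobian of its
projection. -/
lemma area_element_le_of_graph {W A B C D k J p₀ p₁ q₀ q₁ : ℝ}
    (hp : p₀ ^ 2 + p₁ ^ 2 + (A * p₀ + B * p₁) ^ 2 + (C * p₀ + D * p₁) ^ 2 = W)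
    (hq : q₀ ^ 2 + q₁ ^ 2 + (A * q₀ + B * q₁) ^ 2 + (C * q₀ + D * q₁) ^ 2 = W)
    (hpq : p₀ * q₀ + p₁ * q₁ + (A * p₀ + B * p₁) * (A * q₀ + B * q₁) +
      (C * p₀ + D * p₁) * (C * q₀ + D * q₁) = 0)
    (hA : |A| ≤ k) (hB : |B| ≤ k) (hC : |C| ≤ k) (hD : |D| ≤ k)
    (hJ : |p₀ * q₁ - q₀ * p₁| = J) : W ≤ (1 + 4 * k ^ 2 + 4 * k ^ 4) * J := by
  have hk : 0 ≤ k := (abs_nonneg _).trans hA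
  have hJ0 : 0 ≤ J := hJ ▸ abs_nonneg _
  have hA2 : A ^ 2 ≤ k ^ 2 := sq_le_sq.mpr (by rwa [abs_of_nonneg hk])
  have hB2 : B ^ 2 ≤ k ^ 2 := sq_le_sq.mpr (by rwa [abs_of_nonneg hk])
  have hC2 : C ^ 2 ≤ k ^ 2 := sq_le_sq.mpr (by rwa [abs_of_nonneg hk])
  have hD2 : D ^ 2 ≤ k ^ 2 := sq_le_sq.mpr (by rwa [abs_of_nonneg hk])
  have hdet : (A * D - B * C) ^ 2 ≤ 4 * k ^ 4 := by
    have h1 : (A * D - B * C) ^ 2 ≤ 2 * (A ^ 2 * D ^ 2 + B ^ 2 * C ^ 2) := by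
      nlinarith [sq_nonneg (A * D + B * C)]
    have h2 : A ^ 2 * D ^ 2 ≤ k ^ 2 * k ^ 2 := by gcongr
    have h3 : B ^ 2 * C ^ 2 ≤ k ^ 2 * k ^ 2 := by gcongr
    nlinarith
  have hW : W ^ 2 = J ^ 2 * (1 + A ^ 2 + B ^ 2 + C ^ 2 + D ^ 2 + (A * D - B * C) ^ 2) := by
    rw [← hJ, sq_abs]
    have : W ^ 2 = W * W - 0 ^ 2 := by ring
    rw [this, ← hpq]
    nth_rewrite 1 [← hp]
    rw [← hq]
    ring
  set m := 1 + 4 * k ^ 2 + 4 * k ^ 4 with hm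
  have hm1 : 1 ≤ m := by have : 0 ≤ 4 * k ^ 2 + 4 * k ^ 4 := by positivity
                         linarith
  refine abs_le_of_sq_le_sq' ?_ (by positivity) |>.2
  rw [hW, mul_pow, mul_comm]
  gcongr
  nlinarith

lemma det_complex (f : ℂ →L[ℝ] ℂ) :
    f.det = (f 1).re * (f Complex.I).im - (f Complex.I).re * (f 1).im := by
  rw [ContinuousLinearMap.det, ← LinearMap.det_toMatrix Complex.basisOneI, Matrix.det_fin_two]
  simp [LinearMap.toMatrix_apply, Complex.coe_basisOneI_repr]

/-- A conformally parametrized graph, continuous up to the boundary, has finite area. -/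
lemma lintegral_area_element_lt_top {Z : ℂ → E4} {W : ℂ → ℝ}
    (hZ : DifferentiableOn ℝ Z (ball 0 1)) (hZc : ContinuousOn Z (closedBall 0 1))
    (hp : ∀ z ∈ ball (0 : ℂ) 1, ⟪fderiv ℝ Z z 1, fderiv ℝ Z z 1⟫ = W z)
    (hq : ∀ z ∈ ball (0 : ℂ) 1, ⟪fderiv ℝ Z z Complex.I, fderiv ℝ Z z Complex.I⟫ = W z)
    (hpq : ∀ z ∈ ball (0 : ℂ) 1, ⟪fderiv ℝ Z z 1, fderiv ℝ Z z Complex.I⟫ = 0)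
    (hinj : Set.InjOn (fun z => (Z z 0, Z z 1)) (ball 0 1))
    {φ ψ : ℝ × ℝ → ℝ} (hφ : ContDiff ℝ 1 φ) (hψ : ContDiff ℝ 1 ψ)
    (hφZ : ∀ z ∈ ball (0 : ℂ) 1, Z z 2 = φ (Z z 0, Z z 1))
    (hψZ : ∀ z ∈ ball (0 : ℂ) 1, Z z 3 = ψ (Z z 0, Z z 1)) :
    ∫⁻ z in ball (0 : ℂ) 1, ENNReal.ofReal (W z) < ⊤ := by
  have hpair : ContinuousOn (fun z => (Z z 0, Z z 1)) (closedBall (0 : ℂ) 1) := by fun_prop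
  have hcomp := (isCompact_closedBall (0 : ℂ) 1).image_of_continuousOn hpair
  obtain ⟨k₁, hk₁⟩ := hcomp.exists_bound_of_continuousOn
    (hφ.continuous_fderiv one_ne_zero).continuousOn
  obtain ⟨k₂, hk₂⟩ := hcomp.exists_bound_of_continuousOn
    (hψ.continuous_fderiv one_ne_zero).continuousOn
  set k := max k₁ k₂ with hk
  set m := 1 + 4 * k ^ 2 + 4 * k ^ 4 with hm
  have hd : ∀ z ∈ ball (0 : ℂ) 1, HasFDerivAt Z (fderiv ℝ Z z) z := fun z hz =>
    (hZ.differentiableAt (isOpen_ball.mem_nhds hz)).hasFDerivAt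
  have hdi : ∀ i : Fin 4, ∀ z ∈ ball (0 : ℂ) 1,
      HasFDerivAt (fun z => Z z i) ((EuclideanSpace.proj i).comp (fderiv ℝ Z z)) z :=
    fun i z hz => (EuclideanSpace.proj (𝕜 := ℝ) i).hasFDerivAt.comp z (hd z hz)
  have hgraph : ∀ (χ : ℝ × ℝ → ℝ) (i : Fin 4), ContDiff ℝ 1 χ →
      (∀ z ∈ ball (0 : ℂ) 1, Z z i = χ (Z z 0, Z z 1)) → ∀ z ∈ ball (0 : ℂ) 1, ∀ v,
      fderiv ℝ Z z v i = fderiv ℝ χ (Z z 0, Z z 1) (1, 0) * fderiv ℝ Z z v 0 +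
        fderiv ℝ χ (Z z 0, Z z 1) (0, 1) * fderiv ℝ Z z v 1 := by
    intro χ i hχ hχZ z hz v
    have h1 := ((hχ.differentiable one_ne_zero).differentiableAt
      (x := (Z z 0, Z z 1))).hasFDerivAt.comp z ((hdi 0 z hz).prodMk (hdi 1 z hz))
    have h2 := (hdi i z hz).congr_of_eventuallyEq (f₁ := χ ∘ fun z => (Z z 0, Z z 1)) (by
      filter_upwards [isOpen_ball.mem_nhds hz] with w hw using (hχZ w hw).symm)
    have h3 := congrArg (fun T : ℂ →L[ℝ] ℝ => T v) (h2.unique h1)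
    simp only [ContinuousLinearMap.comp_apply, PiLp.proj_apply,
      ContinuousLinearMap.prod_apply] at h3
    have h4 : ((fderiv ℝ Z z v 0, fderiv ℝ Z z v 1) : ℝ × ℝ) =
        fderiv ℝ Z z v 0 • (1, 0) + fderiv ℝ Z z v 1 • (0, 1) := by simp
    rw [h3, h4, map_add, map_smul, map_smul, smul_eq_mul, smul_eq_mul]
    ring
  have hbd : ∀ (χ : ℝ × ℝ → ℝ), (∀ x ∈ (fun z => (Z z 0, Z z 1)) '' closedBall (0 : ℂ) 1,
      ‖fderiv ℝ χ x‖ ≤ k) → ∀ z ∈ ball (0 : ℂ) 1, ∀ v : ℝ × ℝ, ‖v‖ = 1 →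
      |fderiv ℝ χ (Z z 0, Z z 1) v| ≤ k := fun χ hχ z hz v hv => by
    have := (fderiv ℝ χ (Z z 0, Z z 1)).le_opNorm v
    rw [hv, mul_one] at this
    exact this.trans (hχ _ ⟨z, ball_subset_closedBall hz, rfl⟩)
  set gL : E4 →L[ℝ] ℂ := Complex.equivRealProdCLM.symm.toContinuousLinearMap.comp
    ((EuclideanSpace.proj (𝕜 := ℝ) (0 : Fin 4)).prod (EuclideanSpace.proj (𝕜 := ℝ) (1 : Fin 4)))
    with hgL
  have hre : ∀ x : E4, (gL x).re = x 0 := fun x => by simp [hgL]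
  have him : ∀ x : E4, (gL x).im = x 1 := fun x => by simp [hgL]
  have harea := MeasureTheory.lintegral_abs_det_fderiv_eq_addHaar_image MeasureTheory.volume
    (measurableSet_ball (x := (0 : ℂ)) (ε := 1)) (f := fun z => gL (Z z))
    (f' := fun z => gL.comp (fderiv ℝ Z z))
    (fun z hz => (gL.hasFDerivAt.comp z (hd z hz)).hasFDerivWithinAt)
    (fun z hz w hw h => hinj hz hw (by
      have h1 := congrArg Complex.re h
      have h2 := congrArg Complex.im h
      simp only [hre, him] at h1 h2
      exact Prod.ext h1 h2))
  have hfin : MeasureTheory.volume ((fun z => gL (Z z)) '' ball (0 : ℂ) 1) < ⊤ := by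
    refine lt_of_le_of_lt (MeasureTheory.measure_mono
      (Set.image_mono (ball_subset_closedBall))) ?_
    exact ((isCompact_closedBall (0 : ℂ) 1).image_of_continuousOn
      (gL.continuous.comp_continuousOn hZc)).measure_lt_top
  have hle : ∫⁻ z in ball (0 : ℂ) 1, ENNReal.ofReal (W z) ≤
      ∫⁻ z in ball (0 : ℂ) 1, ENNReal.ofReal m *
        ENNReal.ofReal |(gL.comp (fderiv ℝ Z z)).det| := by
    refine MeasureTheory.setLIntegral_mono' measurableSet_ball fun z hz => ?_
    rw [← ENNReal.ofReal_mul (by positivity)]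
    refine ENNReal.ofReal_le_ofReal ?_
    have h1 := hp z hz
    have h2 := hq z hz
    have h3 := hpq z hz
    simp only [PiLp.inner_apply, Fin.sum_univ_four, RCLike.inner_apply, conj_trivial] at h1 h2 h3
    simp only [hgraph φ 2 hφ hφZ z hz, hgraph ψ 3 hψ hψZ z hz] at h1 h2 h3
    have hb₁ := hbd φ (fun x hx => (hk₁ x hx).trans (le_max_left _ _)) z hz
    have hb₂ := hbd ψ (fun x hx => (hk₂ x hx).trans (le_max_right _ _)) z hz
    refine area_element_le_of_graph (p₀ := fderiv ℝ Z z 1 0) (p₁ := fderiv ℝ Z z 1 1)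
      (q₀ := fderiv ℝ Z z Complex.I 0) (q₁ := fderiv ℝ Z z Complex.I 1)
      (by linear_combination h1) (by linear_combination h2) (by linear_combination h3)
      (hb₁ (1, 0) (by simp)) (hb₁ (0, 1) (by simp)) (hb₂ (1, 0) (by simp)) (hb₂ (0, 1) (by simp)) ?_
    rw [det_complex]
    simp only [ContinuousLinearMap.comp_apply, hre, him]
  rw [MeasureTheory.lintegral_const_mul' _ _ ENNReal.ofReal_ne_top, harea] at hle
  exact hle.trans_lt (ENNReal.mul_lt_top ENNReal.ofReal_lt_top hfin)

/-- The standard isometric identification of `ℂ` with the Euclidean plane. -/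
def planeEquiv : ℂ ≃ₗᵢ[ℝ] E2 := Complex.orthonormalBasisOneI.repr

lemma planeEquiv_one : planeEquiv 1 = EuclideanSpace.single 0 1 := by
  simpa [planeEquiv] using Complex.orthonormalBasisOneI.repr_self 0

lemma planeEquiv_I : planeEquiv Complex.I = EuclideanSpace.single 1 1 := by
  simpa [planeEquiv] using Complex.orthonormalBasisOneI.repr_self 1

lemma planeEquiv_mem_ball {z : ℂ} {ρ : ℝ} : planeEquiv z ∈ ball (0 : E2) ρ ↔ z ∈ ball (0 : ℂ) ρ := by
  simp

lemma planeEquiv_mem_closedBall {z : ℂ} {ρ : ℝ} :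
    planeEquiv z ∈ closedBall (0 : E2) ρ ↔ z ∈ closedBall (0 : ℂ) ρ := by
  simp

lemma fderiv_smul_comp_planeEquiv (X : E2 → E4) (k : ℝ) (z v : ℂ) :
    fderiv ℝ (fun z => k • X (planeEquiv z)) z v =
      k • fderiv ℝ X (planeEquiv z) (planeEquiv v) := by
  have h1 := planeEquiv.toContinuousLinearEquiv.comp_right_fderiv (f := X) (x := z)
  have h2 : fderiv ℝ (fun z => k • X (planeEquiv z)) z =
      k • fderiv ℝ (X ∘ planeEquiv.toContinuousLinearEquiv) z :=
    congrFun (fderiv_const_smul_field (f := X ∘ planeEquiv.toContinuousLinearEquiv) k) z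
  rw [h2, h1]
  rfl

lemma fderiv_smul_comp_planeEquiv_one (X : E2 → E4) (k : ℝ) (z : ℂ) :
    fderiv ℝ (fun z => k • X (planeEquiv z)) z 1 = k • pd X 0 (planeEquiv z) := by
  rw [fderiv_smul_comp_planeEquiv, planeEquiv_one, pd]

lemma fderiv_smul_comp_planeEquiv_I (X : E2 → E4) (k : ℝ) (z : ℂ) :
    fderiv ℝ (fun z => k • X (planeEquiv z)) z Complex.I = k • pd X 1 (planeEquiv z) := by
  rw [fderiv_smul_comp_planeEquiv, planeEquiv_I, pd]

lemma isConformalPMC_rescale {X : E2 → E4} {W : E2 → ℝ} {H : E4 → E4} {N₁ N₂ : E2 → E4} {r : ℝ}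
    (hr : 0 < r) (hX : ContDiffOn ℝ 2 X (ball 0 1))
    (hconf : ∀ w ∈ ball (0 : E2) 1,
      ⟪pd X 0 w, pd X 0 w⟫ = W w ∧ ⟪pd X 1 w, pd X 1 w⟫ = W w ∧
      ⟪pd X 0 w, pd X 1 w⟫ = 0 ∧ 0 < W w)
    (hN : ∀ w ∈ ball (0 : E2) 1,
      ‖N₁ w‖ = 1 ∧ ‖N₂ w‖ = 1 ∧ ⟪N₁ w, N₂ w⟫ = 0 ∧
      ⟪N₁ w, pd X 0 w⟫ = 0 ∧ ⟪N₁ w, pd X 1 w⟫ = 0 ∧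
      ⟪N₂ w, pd X 0 w⟫ = 0 ∧ ⟪N₂ w, pd X 1 w⟫ = 0)
    (hpde : ∀ w ∈ ball (0 : E2) 1,
      pd2 X 0 0 w + pd2 X 1 1 w =
        (2 * ⟪H (X w), N₁ w⟫ * W w) • N₁ w + (2 * ⟪H (X w), N₂ w⟫ * W w) • N₂ w) :
    IsConformalPMC (fun z => r⁻¹ • X (planeEquiv z)) (fun z => r⁻¹ ^ 2 * W (planeEquiv z))
      (fun y => r • H (r • y)) := by
  constructor
  · refine ContDiffOn.const_smul _ (hX.comp planeEquiv.contDiff.contDiffOn fun z hz => ?_)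
    exact planeEquiv_mem_ball.mpr hz
  · intro z hz
    rw [fderiv_smul_comp_planeEquiv_one, norm_smul, mul_pow, ← real_inner_self_eq_norm_sq (pd _ _ _),
      (hconf _ (planeEquiv_mem_ball.mpr hz)).1, Real.norm_of_nonneg (by positivity)]
  · intro z hz
    rw [fderiv_smul_comp_planeEquiv_I, norm_smul, mul_pow, ← real_inner_self_eq_norm_sq (pd _ _ _),
      (hconf _ (planeEquiv_mem_ball.mpr hz)).2.1, Real.norm_of_nonneg (by positivity)]
  · intro z hz
    rw [fderiv_smul_comp_planeEquiv_one, fderiv_smul_comp_planeEquiv_I, inner_smul_left,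
      inner_smul_right, (hconf _ (planeEquiv_mem_ball.mpr hz)).2.2.1, mul_zero, mul_zero]
  · intro z hz
    have := (hconf _ (planeEquiv_mem_ball.mpr hz)).2.2.2
    positivity
  · intro z hz
    have hw := planeEquiv_mem_ball.mpr hz
    obtain ⟨h00, h11, h01, hW⟩ := hconf _ hw
    obtain ⟨n1, n2, n12, a1, a2, b1, b2⟩ := hN _ hw
    simp only [fderiv_smul_comp_planeEquiv_one, fderiv_smul_comp_planeEquiv_I]
    have hns := normal_part_eq_scaledNormal (h := H (X (planeEquiv z))) hW
      (by rw [← real_inner_self_eq_norm_sq, h00]) (by rw [← real_inner_self_eq_norm_sq, h11]) h01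
      n1 n2 n12 a1 a2 b1 b2
    have hp := hpde _ hw
    rw [mul_assoc, mul_assoc, mul_smul (2 : ℝ) (_ * _) (N₁ _), mul_smul (2 : ℝ) (_ * _) (N₂ _),
      ← smul_add, hns] at hp
    rw [← pd2, ← pd2, ← smul_add, hp, smul_smul r r⁻¹, mul_inv_cancel₀ hr.ne', one_smul]
    simp only [scaledNormal, smul_sub, smul_smul, inner_smul_left, inner_smul_right, conj_trivial]
    congr 1
    · congr 1 <;> congr 1 <;> field_simp
    · congr 1; field_simp

lemma lintegral_rescaled_area_le {X : E2 → E4} {W : E2 → ℝ} {r d : ℝ}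
    (hr : 0 < r) (hX : DifferentiableOn ℝ X (ball 0 1)) (hXc : ContinuousOn X (closedBall 0 1))
    (hconf : ∀ w ∈ ball (0 : E2) 1,
      ⟪pd X 0 w, pd X 0 w⟫ = W w ∧ ⟪pd X 1 w, pd X 1 w⟫ = W w ∧
      ⟪pd X 0 w, pd X 1 w⟫ = 0 ∧ 0 < W w)
    (hWc : ContinuousOn (fun z => r⁻¹ ^ 2 * W (planeEquiv z)) (ball (0 : ℂ) 1))
    (hinj : Set.InjOn (fun w => (X w 0, X w 1)) (ball (0 : E2) 1))
    {φ ψ : ℝ × ℝ → ℝ} (hφ : ContDiff ℝ 1 φ) (hψ : ContDiff ℝ 1 ψ)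
    (hg : ∀ w ∈ ball (0 : E2) 1, X w 2 = φ (X w 0, X w 1) ∧ X w 3 = ψ (X w 0, X w 1))
    (hE : (∫ w in ball (0 : E2) 1, (‖pd X 0 w‖ ^ 2 + ‖pd X 1 w‖ ^ 2)) ≤ d * r ^ 2) :
    ∫⁻ z in ball (0 : ℂ) 1, ENNReal.ofReal (r⁻¹ ^ 2 * W (planeEquiv z)) ≤
      ENNReal.ofReal (d / 2) := by
  have hr2 : 0 < r⁻¹ ^ 2 := by positivity
  have e1 := fun z : ℂ => fderiv_smul_comp_planeEquiv_one X 1 z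
  have eI := fun z : ℂ => fderiv_smul_comp_planeEquiv_I X 1 z
  simp only [one_smul] at e1 eI
  have hfin := lintegral_area_element_lt_top (Z := fun z => X (planeEquiv z))
    (W := fun z => W (planeEquiv z))
    (hX.comp planeEquiv.differentiable.differentiableOn fun z hz => planeEquiv_mem_ball.mpr hz)
    (hXc.comp planeEquiv.continuous.continuousOn fun z hz => planeEquiv_mem_closedBall.mpr hz)
    (fun z hz => by rw [e1]; exact (hconf _ (planeEquiv_mem_ball.mpr hz)).1)
    (fun z hz => by rw [eI]; exact (hconf _ (planeEquiv_mem_ball.mpr hz)).2.1)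
    (fun z hz => by rw [e1, eI]; exact (hconf _ (planeEquiv_mem_ball.mpr hz)).2.2.1)
    (fun z hz w hw h => planeEquiv.injective
      (hinj (planeEquiv_mem_ball.mpr hz) (planeEquiv_mem_ball.mpr hw) h))
    hφ hψ (fun z hz => (hg _ (planeEquiv_mem_ball.mpr hz)).1)
    (fun z hz => (hg _ (planeEquiv_mem_ball.mpr hz)).2)
  have hnn : 0 ≤ᵐ[MeasureTheory.volume.restrict (ball (0 : ℂ) 1)]
      fun z => r⁻¹ ^ 2 * W (planeEquiv z) := by
    filter_upwards [MeasureTheory.ae_restrict_mem measurableSet_ball] with z hz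
    have := (hconf _ (planeEquiv_mem_ball.mpr hz)).2.2.2
    simp only [Pi.zero_apply]
    positivity
  have hfi : MeasureTheory.Integrable (fun z => r⁻¹ ^ 2 * W (planeEquiv z))
      (MeasureTheory.volume.restrict (ball (0 : ℂ) 1)) := by
    refine ⟨hWc.aestronglyMeasurable measurableSet_ball, ?_⟩
    rw [MeasureTheory.hasFiniteIntegral_iff_ofReal hnn]
    simp_rw [ENNReal.ofReal_mul hr2.le]
    rw [MeasureTheory.lintegral_const_mul' _ _ ENNReal.ofReal_ne_top]
    exact ENNReal.mul_lt_top ENNReal.ofReal_lt_top hfin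
  rw [← MeasureTheory.ofReal_integral_eq_lintegral_ofReal hfi hnn]
  refine ENNReal.ofReal_le_ofReal ?_
  rw [MeasureTheory.integral_const_mul]
  have htr := planeEquiv.measurePreserving.setIntegral_preimage_emb
    planeEquiv.toHomeomorph.measurableEmbedding W (ball 0 1)
  rw [LinearIsometryEquiv.preimage_ball, map_zero] at htr
  have h2 : ∫ w in ball (0 : E2) 1, (‖pd X 0 w‖ ^ 2 + ‖pd X 1 w‖ ^ 2) =
      2 * ∫ w in ball (0 : E2) 1, W w := by
    rw [← MeasureTheory.integral_const_mul]
    refine MeasureTheory.setIntegral_congr_fun measurableSet_ball fun w hw => ?_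
    obtain ⟨h00, h11, -⟩ := hconf w hw
    simp only [← real_inner_self_eq_norm_sq, h00, h11]
    ring
  rw [htr]
  rw [h2] at hE
  have h3 : d / 2 = r⁻¹ ^ 2 * (d * r ^ 2 / 2) := by field_simp
  rw [h3]
  gcongr
  linarith

/-- The sum of the squared principal curvatures in terms of the Laplacian and the Hopf
coefficients. -/
lemma four_sq_sub_two_mul_le {P Q t W m k κ r A : ℝ} (hr : 0 < r) (hκ : 0 < κ)
    (hW : κ ≤ r⁻¹ ^ 2 * W) (hPQ : r⁻¹ * |P + Q| ≤ m * (r⁻¹ ^ 2 * W)) (hd : r⁻¹ * |P - Q| ≤ k)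
    (ht : r⁻¹ * |t| ≤ k) :
    4 * ((P + Q) / (2 * W)) ^ 2 - 2 * ((P * Q - t ^ 2) / W ^ 2) ≤
      1 / r ^ 2 * (A ^ 2 + (m ^ 2 + 3 * k ^ 2 / κ ^ 2 + 1)) := by
  obtain ⟨V, rfl⟩ : ∃ V, W = r ^ 2 * V := ⟨r⁻¹ ^ 2 * W, by field_simp⟩
  obtain ⟨s, hs⟩ : ∃ s, P + Q = r * s := ⟨r⁻¹ * (P + Q), by field_simp⟩
  obtain ⟨u, hu⟩ : ∃ u, P - Q = r * u := ⟨r⁻¹ * (P - Q), by field_simp⟩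
  obtain ⟨t, rfl⟩ : ∃ t', t = r * t' := ⟨r⁻¹ * t, by field_simp⟩
  have e1 : ∀ x : ℝ, r⁻¹ * |r * x| = |x| := fun x => by
    rw [abs_mul, abs_of_pos hr]; field_simp
  have e2 : r⁻¹ ^ 2 * (r ^ 2 * V) = V := by field_simp
  rw [hs, e1, e2] at hPQ
  rw [hu, e1] at hd
  rw [e1] at ht
  rw [e2] at hW
  have hV : 0 < V := hκ.trans_le hW
  have hs2 : s ^ 2 ≤ (m * V) ^ 2 := sq_le_sq.mpr (hPQ.trans (le_abs_self _))
  have hu2 : u ^ 2 ≤ k ^ 2 := sq_le_sq.mpr (hd.trans (le_abs_self _))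
  have ht2 : t ^ 2 ≤ k ^ 2 := sq_le_sq.mpr (ht.trans (le_abs_self _))
  have hlhs : 4 * ((P + Q) / (2 * (r ^ 2 * V))) ^ 2 - 2 * ((P * Q - (r * t) ^ 2) / (r ^ 2 * V) ^ 2)
      = 1 / r ^ 2 * ((s ^ 2 / 2 + u ^ 2 / 2 + 2 * t ^ 2) / V ^ 2) := by
    have hP : P = r * (s + u) / 2 := by linarith
    have hQ : Q = r * (s - u) / 2 := by linarith
    rw [hP, hQ]
    field_simp
    ring
  rw [hlhs]
  gcongr
  have h1 : (s ^ 2 / 2 + u ^ 2 / 2 + 2 * t ^ 2) / V ^ 2 ≤ (m * V) ^ 2 / V ^ 2 + 3 * k ^ 2 / κ ^ 2 := by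
    have h4 : 3 * k ^ 2 / V ^ 2 ≤ 3 * k ^ 2 / κ ^ 2 := by gcongr
    have h5 : (s ^ 2 / 2 + u ^ 2 / 2 + 2 * t ^ 2) / V ^ 2 ≤ ((m * V) ^ 2 + 3 * k ^ 2) / V ^ 2 := by
      refine div_le_div_of_nonneg_right ?_ (sq_nonneg V)
      linarith [sq_nonneg s, sq_nonneg k]
    rw [add_div ((m * V) ^ 2)] at h5
    linarith
  have h6 : (m * V) ^ 2 / V ^ 2 = m ^ 2 := by field_simp
  rw [h6] at h1
  nlinarith [sq_nonneg A]

/-- **Main theorem (a priori estimate of the principal curvatures).** For a conformally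
parametrized graph in `ℝ⁴` of prescribed mean curvature `𝓗(X,Z) = 𝓗̄(X)·Z` with
`|𝓗| ≤ h₀/2` and Hölder continuous `𝓗`, representing a geodesic disc of radius `r`
centered at the origin, with Dirichlet energy at most `d₀r²` and all of whose normals
make an angle at least `ω` with the `x¹`-axis, there exists a constant
`Θ = Θ(h₀r, h₁r^{1+α}, h₂r, d₀, sin ω, α)` with
`κ₁² + κ₂² = 4H² − 2K ≤ (1/r²)((h₀r)² + Θ)` at the center, for every normal
direction `N` there. -/
theorem curvature_estimate_prescribed_mean_curvature_graph_R4
    (α : ℝ) (hα : α ∈ Set.Ioo (0 : ℝ) 1)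
    (ω : ℝ) (hω : ω ∈ Set.Ioc 0 (π / 2))
    (d₀ : ℝ) (hd₀ : 0 < d₀)
    (a b c : ℝ) (ha : 0 ≤ a) (hb : 0 ≤ b) (hc : 0 ≤ c) :
    ∃ Θ : ℝ, 0 < Θ ∧
      ∀ (r h₀ h₁ h₂ : ℝ), 0 < r → 0 ≤ h₀ → 0 ≤ h₁ → 0 ≤ h₂ →
        h₀ * r ≤ a → h₁ * r ^ (1 + α) ≤ b → h₂ * r ≤ c →
      ∀ (𝓗 : E4 → E4 → ℝ) (𝓗bar : E4 → E4),
        Continuous 𝓗bar →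
        (∀ x z : E4, 𝓗 x z = ⟪𝓗bar x, z⟫) →
        (∀ x z : E4, ‖z‖ = 1 → |𝓗 x z| ≤ h₀ / 2) →
        (∀ x₁ x₂ z₁ z₂ : E4, ‖z₁‖ = 1 → ‖z₂‖ = 1 →
          |𝓗 x₁ z₁ - 𝓗 x₂ z₂| ≤ h₁ * ‖x₁ - x₂‖ ^ α + h₂ * ‖z₁ - z₂‖) →
      ∀ (X : E2 → E4) (W : E2 → ℝ),
        ContDiffOn ℝ 2 X (ball (0 : E2) 1) →
        ContinuousOn X (closedBall (0 : E2) 1) →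
        -- conformal parametrization with area element W
        (∀ w ∈ ball (0 : E2) 1,
          ⟪pd X 0 w, pd X 0 w⟫ = W w ∧ ⟪pd X 1 w, pd X 1 w⟫ = W w ∧
          ⟪pd X 0 w, pd X 1 w⟫ = 0 ∧ 0 < W w) →
        -- (A1) conformal reparametrization of a positively oriented graph
        Set.InjOn (fun w => (X w 0, X w 1)) (ball (0 : E2) 1) →
        (∀ w ∈ ball (0 : E2) 1,
          0 < pdR (fun w' => X w' 0) 0 w * pdR (fun w' => X w' 1) 1 w
              - pdR (fun w' => X w' 0) 1 w * pdR (fun w' => X w' 1) 0 w) →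
        (∃ φ ψ : ℝ × ℝ → ℝ, ContDiff ℝ 2 φ ∧ ContDiff ℝ 2 ψ ∧
          ∀ w ∈ ball (0 : E2) 1,
            X w 2 = φ (X w 0, X w 1) ∧ X w 3 = ψ (X w 0, X w 1)) →
      ∀ N₁ N₂ : E2 → E4,
        ContDiffOn ℝ 1 N₁ (ball (0 : E2) 1) →
        ContDiffOn ℝ 1 N₂ (ball (0 : E2) 1) →
        (∀ w ∈ ball (0 : E2) 1,
          ‖N₁ w‖ = 1 ∧ ‖N₂ w‖ = 1 ∧ ⟪N₁ w, N₂ w⟫ = 0 ∧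
          ⟪N₁ w, pd X 0 w⟫ = 0 ∧ ⟪N₁ w, pd X 1 w⟫ = 0 ∧
          ⟪N₂ w, pd X 0 w⟫ = 0 ∧ ⟪N₂ w, pd X 1 w⟫ = 0) →
        -- the prescribed mean curvature system
        (∀ w ∈ ball (0 : E2) 1,
          pd2 X 0 0 w + pd2 X 1 1 w =
            (2 * 𝓗 (X w) (N₁ w) * W w) • N₁ w
              + (2 * 𝓗 (X w) (N₂ w) * W w) • N₂ w) →
        -- (A3) geodesic disc of radius r with center X(0,0) = 0
        X 0 = 0 →
        (∀ γ : ℝ → E2, ContDiff ℝ 1 γ →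
          (∀ t ∈ Set.Icc (0 : ℝ) 1, γ t ∈ closedBall (0 : E2) 1) →
          γ 0 = 0 → ‖γ 1‖ = 1 →
          r ≤ ∫ t in (0 : ℝ)..1, ‖deriv (X ∘ γ) t‖) →
        -- (A4) Dirichlet energy bound
        (∫ w in ball (0 : E2) 1, (‖pd X 0 w‖ ^ 2 + ‖pd X 1 w‖ ^ 2)) ≤ d₀ * r ^ 2 →
        -- (A5) all normals make an angle of at least ω with the x¹-axis
        (∀ w ∈ ball (0 : E2) 1, ∀ N : E4, ‖N‖ = 1 →
          ⟪N, pd X 0 w⟫ = 0 → ⟪N, pd X 1 w⟫ = 0 →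
          |⟪N, EuclideanSpace.single (0 : Fin 4) 1⟫| ≤ Real.cos ω) →
      -- conclusion: curvature estimate at the center
      ∀ N : E4, ‖N‖ = 1 → ⟪N, pd X 0 0⟫ = 0 → ⟪N, pd X 1 0⟫ = 0 →
        4 * (⟪pd2 X 0 0 0 + pd2 X 1 1 0, N⟫ / (2 * W 0)) ^ 2
            - 2 * ((⟪pd2 X 0 0 0, N⟫ * ⟪pd2 X 1 1 0, N⟫ - ⟪pd2 X 0 1 0, N⟫ ^ 2)
                / W 0 ^ 2) ≤
          (1 / r ^ 2) * ((h₀ * r) ^ 2 + Θ) := by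
  obtain ⟨hα0, hα1⟩ := hα
  have hs : 0 < sin ω := sin_pos_of_pos_of_lt_pi hω.1 (by linarith [hω.2, pi_pos])
  obtain ⟨κ, L, hκ, hL, hmain⟩ := exists_area_element_bounds E4 (s := sin ω) (A := a / 2)
    (E := d₀ / 2) hs (by positivity) (by positivity)
  set K := 2 * (2 * L + 6 * (a / 2) * L ^ 2) / (1 / 16) + 2 * (6 * (b * L ^ α * L ^ 2 +
      2 * (a / 2) * L * (2 * L + 12 * (a / 2) * L ^ 2))) * (1 / 16) ^ (α / 2) / (α / 2) with hK
  refine ⟨(6 * (a / 2)) ^ 2 + 3 * K ^ 2 / κ ^ 2 + 1, by positivity, ?_⟩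
  intro r h₀ h₁ h₂ hr hh₀ hh₁ hh₂ hra hrb hrc 𝓗 H hHc h𝓗 hHbd hHol X W hX hXc hconf hinj hjac
    hgraph N₁ N₂ hN₁ hN₂ hN hpde hX0 hlen hE hang N hN1 hNu hNv
  obtain ⟨φ, ψ, hφ, hψ, hg⟩ := hgraph
  simp only [h𝓗] at hHbd hHol hpde
  have hY := isConformalPMC_rescale hr hX hconf hN hpde
  have h0 : (0 : ℂ) ∈ ball (0 : ℂ) 1 := mem_ball_self one_pos
  have hHA : ∀ y : E4, ‖r • H (r • y)‖ ≤ a / 2 := fun y => by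
    have h1 := norm_le_of_forall_abs_inner_le (by positivity) (hHbd (r • y))
    rw [norm_smul, Real.norm_of_nonneg hr.le]
    calc r * ‖H (r • y)‖ ≤ r * (h₀ / 2) := by gcongr
      _ ≤ a / 2 := by linarith
  have hHb : ∀ x y : E4, ‖r • H (r • x) - r • H (r • y)‖ ≤ b * ‖x - y‖ ^ α := fun x y => by
    have h1 : ‖H (r • x) - H (r • y)‖ ≤ h₁ * ‖r • x - r • y‖ ^ α :=
      norm_le_of_forall_abs_inner_le (by positivity) fun z hz => by
        have := hHol (r • x) (r • y) z z hz hz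
        rwa [← inner_sub_left, sub_self, norm_zero, mul_zero, add_zero] at this
    rw [← smul_sub] at h1
    rw [← smul_sub, norm_smul, Real.norm_of_nonneg hr.le]
    rw [norm_smul, Real.norm_of_nonneg hr.le, mul_rpow hr.le (norm_nonneg _)] at h1
    calc r * ‖H (r • x) - H (r • y)‖ ≤ r * (h₁ * (r ^ α * ‖x - y‖ ^ α)) := by gcongr
      _ = h₁ * r ^ (1 + α) * ‖x - y‖ ^ α := by rw [rpow_add hr, rpow_one]; ring
      _ ≤ b * ‖x - y‖ ^ α := by gcongr
  have hang' : ∀ z ∈ ball (0 : ℂ) 1, sin ω ^ 2 * (r⁻¹ ^ 2 * W (planeEquiv z)) ≤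
      ‖cgrad (fun w => ⟪(EuclideanSpace.single (0 : Fin 4) (1 : ℝ) : E4),
        r⁻¹ • X (planeEquiv w)⟫) z‖ ^ 2 := fun z hz => by
    rw [norm_cgrad_inner_const_sq (hY.differentiableAt hz)]
    refine sq_sin_mul_le (hY.pos z hz) (hY.norm_one z hz) (hY.norm_I z hz)
      (hY.inner_eq_zero z hz) (by simp) fun n hn hnp hnq => ?_
    rw [fderiv_smul_comp_planeEquiv_one, inner_smul_right] at hnp
    rw [fderiv_smul_comp_planeEquiv_I, inner_smul_right] at hnq
    have hr' := inv_ne_zero hr.ne'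
    exact hang _ (planeEquiv_mem_ball.mpr hz) n hn ((mul_eq_zero.mp hnp).resolve_left hr')
      ((mul_eq_zero.mp hnq).resolve_left hr')
  have hlen' : ∀ e : ℂ, ‖e‖ = 1 →
      1 ≤ ∫ t in (0 : ℝ)..1, ‖deriv (fun t : ℝ => r⁻¹ • X (planeEquiv (t • e))) t‖ := fun e he => by
    have h1 := hlen (fun t => planeEquiv (t • e))
      (planeEquiv.contDiff.comp (contDiff_id.smul contDiff_const))
      (fun t ht => by
        rw [planeEquiv_mem_closedBall, mem_closedBall_zero_iff, norm_smul, he, mul_one,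
          Real.norm_of_nonneg ht.1]
        exact ht.2) (by simp) (by simp [he])
    have h2 : ∀ t : ℝ, ‖deriv (fun t : ℝ => r⁻¹ • X (planeEquiv (t • e))) t‖ =
        r⁻¹ * ‖deriv (X ∘ fun t : ℝ => planeEquiv (t • e)) t‖ := fun t => by
      rw [← Real.norm_of_nonneg (inv_pos.mpr hr).le, ← norm_smul,
        Real.norm_of_nonneg (inv_pos.mpr hr).le]
      exact congrArg _ (deriv_fun_const_smul_field r⁻¹ _)
    simp only [h2]
    rw [intervalIntegral.integral_const_mul]
    calc (1 : ℝ) = r⁻¹ * r := (inv_mul_cancel₀ hr.ne').symm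
      _ ≤ _ := by gcongr
  obtain ⟨hκW, hLW⟩ := hmain _ _ _ (EuclideanSpace.single (0 : Fin 4) (1 : ℝ)) hY hHA (by simp)
    hang' (lintegral_rescaled_area_le hr (hX.differentiableOn two_ne_zero) hXc hconf
      hY.continuousOn_area hinj (hφ.of_le one_le_two) (hψ.of_le one_le_two) hg hE) hlen'
  obtain ⟨hdiag, hoff⟩ := hY.second_derivative_le (by positivity) hHA hb hα0 hα1 hHb hL hLW hK
  have hlap : ‖fderiv ℝ (fun w => fderiv ℝ (fun z => r⁻¹ • X (planeEquiv z)) w 1) 0 1 +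
      fderiv ℝ (fun w => fderiv ℝ (fun z => r⁻¹ • X (planeEquiv z)) w Complex.I) 0 Complex.I‖ ≤
        6 * (a / 2) * (r⁻¹ ^ 2 * W (planeEquiv 0)) := by
    rw [hY.laplacian 0 h0, norm_smul, Real.norm_two]
    linarith [norm_scaledNormal_le (hHA (r⁻¹ • X (planeEquiv 0))) (hY.norm_one 0 h0)
      (hY.norm_I 0 h0)]
  have hpd2 : ∀ i j w, pd (pd X i) j w = pd2 X i j w := fun _ _ _ => rfl
  simp only [fderiv_smul_comp_planeEquiv_one, fderiv_smul_comp_planeEquiv_I, map_zero, hpd2]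
    at hlap hdiag hoff hκW
  rw [← smul_add, norm_smul, Real.norm_of_nonneg (inv_pos.mpr hr).le] at hlap
  rw [← smul_sub, norm_smul, Real.norm_of_nonneg (inv_pos.mpr hr).le] at hdiag
  rw [norm_smul, Real.norm_of_nonneg (inv_pos.mpr hr).le] at hoff
  have hin : ∀ v : E4, |⟪v, N⟫| ≤ ‖v‖ := fun v => by
    simpa [hN1] using abs_real_inner_le_norm v N
  rw [inner_add_left]
  refine four_sq_sub_two_mul_le hr hκ hκW (hlap.trans' ?_) (hdiag.trans' ?_) (hoff.trans' ?_)
  · rw [← inner_add_left]; gcongr; exact hin _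
  · rw [← inner_sub_left]; gcongr; exact hin _
  · gcongr; exact hin _
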